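/- There is a constant C = C(n) such that for all holomorphic functions f : B_n → ℓ² and g : B_n → ℓ², ∫_{B_n} ‖f(z)‖_{ℓ²} ‖Rg(z)‖_{ℓ²}² |z|^{−2n} log(1/|z|) dV(z) ≤ C · ‖ (1−|z|²)^{n/2+1} ‖g′(z)‖_{HS} ‖_{CM}² · sup_{0<r<1} ∫_{∂B_n} ‖f(rζ)‖_{ℓ²} dσ(ζ), where Rg(z) = Σ_{j=1}^n z_j ∂g/∂z_j(z) is the radial derivative, g′(z) = (∂g_i/∂z_j(z))_{i,j} with Hilbert–Schmidt norm ‖·‖_{HS}, and the CM norm is applied to the scalar function z ↦ (1−|z|²)^{n/2+1} ‖g′(z)‖_{HS}. -/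

import Mathlib

open MeasureTheory Metric Set Complex Topology
open scoped ENNReal NNReal

noncomputable section

/-- `ℂⁿ` with the Euclidean (Hermitian) norm: the ball `B_n` is `Metric.ball 0 1`. -/
abbrev En (n : ℕ) : Type := EuclideanSpace ℂ (Fin n)

instance (n : ℕ) : MeasurableSpace (En n) := borel _
instance (n : ℕ) : BorelSpace (En n) := ⟨rfl⟩

/-- The Hilbert space `ℓ²` of square-summable complex sequences. -/
abbrev l2 : Type := lp (fun _ : ℕ => ℂ) 2

/-- The pairing `⟨z,w⟩ = ∑_j z_j conj (w_j)`. -/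
def herm {n : ℕ} (z w : En n) : ℂ := ∑ j, z j * (starRingEnd ℂ) (w j)

/-- The Carleson tent `S_ζ`. -/
def tent {n : ℕ} (ζ : En n) : Set (En n) :=
  {z ∈ ball (0 : En n) 1 | 1 / 2 < (1 - ‖ζ‖) / ‖1 - herm z ζ‖}

/-- The measure `λ_n` on `B_n`, `dλ_n(z) = (1-|z|²)^{-n-1} dV(z)`. -/
def lambdaM (n : ℕ) : Measure (En n) :=
  ((volume : Measure (En n)).restrict (ball (0 : En n) 1)).withDensity
    fun z => ENNReal.ofReal ((1 - ‖z‖ ^ 2) ^ (-(n : ℝ) - 1))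

/-- The normalized rotation-invariant surface measure `σ` on the unit sphere `∂B_n`. -/
def sphereM (n : ℕ) : Measure (sphere (0 : En n) 1) :=
  (((volume : Measure (En n)).toSphere) Set.univ)⁻¹ • ((volume : Measure (En n)).toSphere)

/-- The squared Hilbert–Schmidt norm of the holomorphic derivative `f′(z) = (∂f_i/∂z_j)`. -/
def hsSq {n : ℕ} (f : En n → l2) (z : En n) : ℝ :=
  ∑' i : ℕ, ∑ j, ‖(fderiv ℂ f z (EuclideanSpace.single j 1)) i‖ ^ 2

/-- The squared Carleson-measure norm `‖g‖_CM²` of a scalar function on the ball. -/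
def cmSq {n : ℕ} (g : En n → ℝ) : ℝ≥0∞ :=
  ⨆ (ζ : En n) (_ : ζ ∈ ball (0 : En n) 1 \ {0}),
    (ENNReal.ofReal ((1 - ‖ζ‖) ^ n))⁻¹ *
      ∫⁻ z in tent ζ, ENNReal.ofReal ((g z) ^ 2) ∂(lambdaM n)

/-- The radial derivative `Rg(z) = ∑_j z_j ∂g/∂z_j(z)` of `g : B_n → ℓ²`. -/
def radD {n : ℕ} (g : En n → l2) (z : En n) : l2 :=
  ∑ j, z j • fderiv ℂ g z (EuclideanSpace.single j 1)

/-- The `H¹(B_n; ℓ²)` norm `sup_{0<r<1} ∫_{∂B_n} ‖f(rζ)‖ dσ(ζ)`. -/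
def h1Ball {n : ℕ} (f : En n → l2) : ℝ≥0∞ :=
  ⨆ (r : ℝ) (_ : r ∈ Ioo (0 : ℝ) 1),
    ∫⁻ ζ : sphere (0 : En n) 1, ENNReal.ofReal ‖f (r • (ζ : En n))‖ ∂(sphereM n)


lemma sqrt_norm_le_circleAverage {h : ℂ → ℂ} {c : ℂ} {R : ℝ} (hR : 0 < R)
    (hh : AnalyticOnNhd ℂ h (closedBall c R)) :
    √‖h c‖ ≤ Real.circleAverage (fun z => √‖h z‖) c R := by
  by_cases h0 : h c = 0
  · simp only [h0, norm_zero, Real.sqrt_zero]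
    apply Real.circleAverage_nonneg_of_nonneg
    intro x hx
    positivity
  have habs : |R| = R := abs_of_pos hR
  have hh' : AnalyticOnNhd ℂ h (closedBall c |R|) := by rwa [habs]
  have hq : 0 < ‖h c‖ := norm_pos_iff.2 h0
  set q := √‖h c‖ with hqdef
  have hqpos : 0 < q := Real.sqrt_pos.2 hq
  have hJ := hh'.circleAverage_log_norm hR.ne' h0
  have hJ2 : Real.log ‖h c‖ ≤ Real.circleAverage (fun z => Real.log ‖h z‖) c R := by
    rw [hJ]
    have : 0 ≤ ∑ᶠ u, (MeromorphicOn.divisor h (closedBall c |R|) u : ℝ) *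
        Real.log (R * ‖c - u‖⁻¹) := by
      apply finsum_nonneg
      intro u
      by_cases hu : u ∈ closedBall c |R|
      · refine mul_nonneg (mod_cast MeromorphicOn.AnalyticOnNhd.divisor_nonneg hh' u) ?_
        by_cases huc : u = c
        · simp [huc]
        · have : 0 < ‖c - u‖ := norm_pos_iff.2 (sub_ne_zero.2 (Ne.symm huc))
          apply Real.log_nonneg
          rw [← div_eq_mul_inv, le_div_iff₀ this, one_mul]
          rw [habs, mem_closedBall, dist_eq_norm'] at hu
          exact hu
      · simp [hu]
    linarith
  have hci : CircleIntegrable (fun z => Real.log ‖h z‖) c R :=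
    (hh'.mono sphere_subset_closedBall).meromorphicOn.circleIntegrable_log_norm
  set f1 : ℂ → ℝ := fun z => q * (1 - Real.log ‖h c‖ / 2) + (q / 2) * Real.log ‖h z‖ with hf1
  have hf1i : CircleIntegrable f1 c R := by
    apply CircleIntegrable.add
    · exact circleIntegrable_const _ _ _
    · simpa using hci.const_fun_smul (a := q / 2)
  have hav : Real.circleAverage f1 c R = q * (1 - Real.log ‖h c‖ / 2) +
      (q/2) * Real.circleAverage (fun z => Real.log ‖h z‖) c R := by
    have := Real.circleAverage_add (c := c) (R := R) (f₁ := fun _ : ℂ => q * (1 - Real.log ‖h c‖ / 2))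
      (f₂ := fun z => (q/2) • Real.log ‖h z‖) (circleIntegrable_const _ _ _)
      (hci.const_fun_smul (a := q / 2))
    rw [Real.circleAverage_const, Real.circleAverage_fun_smul] at this
    simpa [hf1, Pi.add_def] using this
  set f2 : ℂ → ℝ := fun z => if h z = 0 then f1 z else √‖h z‖ with hf2
  have hcod : (fun z => √‖h z‖) =ᶠ[Filter.codiscreteWithin (sphere c |R|)] f2 := by
    have h1 := hh'.preimage_zero_mem_codiscreteWithin h0 (by simp)
      ((convex_closedBall c |R|).isConnected ⟨c, by simp⟩)
    have h2 := Filter.codiscreteWithin_mono (sphere_subset_closedBall (x := c) (ε := |R|)) h1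
    filter_upwards [h2] with z hz
    simp only [mem_preimage, mem_compl_iff, mem_singleton_iff] at hz
    simp [hf2, hz]
  have hsi : CircleIntegrable (fun z => √‖h z‖) c R := by
    apply ContinuousOn.circleIntegrable hR.le
    exact (hh.continuousOn.mono sphere_subset_closedBall).norm.sqrt
  have hf2i : CircleIntegrable f2 c R := hsi.congr_codiscreteWithin hcod
  rw [Real.circleAverage_congr_codiscreteWithin hcod hR.ne']
  calc q ≤ Real.circleAverage f1 c R := by
        rw [hav]; nlinarith
    _ ≤ _ := by
        apply Real.circleAverage_mono hf1i hf2i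
        intro z _
        simp only [hf2]
        split_ifs with hz
        · rfl
        · have hz' : 0 < ‖h z‖ := norm_pos_iff.2 hz
          have h3 := Real.add_one_le_exp ((Real.log ‖h z‖ - Real.log ‖h c‖)/2)
          have h4 : Real.exp ((Real.log ‖h z‖ - Real.log ‖h c‖)/2) = √‖h z‖ / q := by
            rw [hqdef, ← Real.sqrt_div' _ hq.le, Real.exp_half, Real.exp_sub, Real.exp_log hz',
              Real.exp_log hq]
          rw [h4] at h3
          rw [le_div_iff₀ hqpos] at h3
          simp only [hf1]
          nlinarith

lemma sqrt_norm_le_circleAverage_l2 {f : ℂ → l2} {R : ℝ} (hR : 1 < R)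
    (hf : DifferentiableOn ℂ f (ball 0 R)) :
    √‖f 0‖ ≤ Real.circleAverage (fun z => √‖f z‖) 0 1 := by
  have hsub : closedBall (0:ℂ) 1 ⊆ ball 0 R := closedBall_subset_ball hR
  by_cases h0 : f 0 = 0
  · simp only [h0, norm_zero, Real.sqrt_zero]
    apply Real.circleAverage_nonneg_of_nonneg
    intro x hx
    positivity
  have hp : 0 < ‖f 0‖ := norm_pos_iff.2 h0
  set e : l2 := ((‖f 0‖⁻¹ : ℝ) : ℂ) • f 0 with he
  have hen : ‖e‖ = 1 := by
    rw [he, norm_smul]; simp [hp.ne']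
  set h : ℂ → ℂ := fun z => inner ℂ e (f z) with hh
  have hhd : DifferentiableOn ℂ h (ball 0 R) := by
    have : h = fun z => (innerSL ℂ e) (f z) := by ext z; simp [hh]
    rw [this]
    exact (innerSL ℂ e).differentiable.comp_differentiableOn hf
  have hha : AnalyticOnNhd ℂ h (closedBall 0 1) := (hhd.analyticOnNhd isOpen_ball).mono hsub
  have h1 := sqrt_norm_le_circleAverage one_pos hha
  have h00 : ‖h 0‖ = ‖f 0‖ := by
    simp only [hh, he, inner_smul_left, inner_self_eq_norm_sq_to_K]
    simp
    field_simp
  rw [← h00]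
  refine h1.trans ?_
  have hs : sphere (0:ℂ) 1 ⊆ ball 0 R := sphere_subset_closedBall.trans hsub
  apply Real.circleAverage_mono
  · exact ContinuousOn.circleIntegrable zero_le_one ((hhd.continuousOn.mono hs).norm.sqrt)
  · exact ContinuousOn.circleIntegrable zero_le_one ((hf.continuousOn.mono hs).norm.sqrt)
  · intro z hz
    apply Real.sqrt_le_sqrt
    calc ‖h z‖ ≤ ‖e‖ * ‖f z‖ := norm_inner_le_norm _ _
      _ = _ := by rw [hen, one_mul]

/-- ENNReal version of circle sub-mean. -/
lemma circleAverage_to_lintegral {u : ℂ → ℝ} {R : ℝ} (hR : 1 < R) (hu : ContinuousOn u (ball 0 R))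
    (hpos : ∀ z, 0 ≤ u z) (h : u 0 ≤ Real.circleAverage u 0 1) :
    ENNReal.ofReal (2 * Real.pi) * ENNReal.ofReal (u 0) ≤
      ∫⁻ θ in Ioc (0:ℝ) (2 * Real.pi), ENNReal.ofReal (u (Complex.exp (θ * I))) := by
  have hpi : 0 < 2 * Real.pi := Real.two_pi_pos
  have hs : sphere (0:ℂ) 1 ⊆ ball 0 R := sphere_subset_closedBall.trans (closedBall_subset_ball hR)
  have hci : CircleIntegrable u 0 1 := ContinuousOn.circleIntegrable zero_le_one (hu.mono hs)
  rw [← ofReal_integral_eq_lintegral_ofReal]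
  · rw [← ENNReal.ofReal_mul hpi.le]
    apply ENNReal.ofReal_le_ofReal
    rw [Real.circleAverage_def, intervalIntegral.integral_of_le hpi.le, smul_eq_mul] at h
    simp only [circleMap, zero_add, ofReal_one, one_mul] at h
    rw [inv_mul_eq_div, le_div_iff₀ hpi] at h
    linarith
  · have := hci
    unfold CircleIntegrable at this
    rw [intervalIntegrable_iff_integrableOn_Ioc_of_le hpi.le] at this
    simp only [circleMap, zero_add, ofReal_one, one_mul] at this
    exact this
  · exact Filter.Eventually.of_forall fun θ => hpos _

lemma submean_l2 {f : ℂ → l2} {R : ℝ} (hR : 1 < R) (hf : DifferentiableOn ℂ f (ball 0 R)) :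
    ENNReal.ofReal (2 * Real.pi) * ENNReal.ofReal (√‖f 0‖) ≤
      ∫⁻ θ in Ioc (0:ℝ) (2 * Real.pi), ENNReal.ofReal (√‖f (Complex.exp (θ * I))‖) :=
  circleAverage_to_lintegral hR hf.continuousOn.norm.sqrt (fun _ => Real.sqrt_nonneg _)
    (sqrt_norm_le_circleAverage_l2 hR hf)


lemma finrank_En (n : ℕ) : Module.finrank ℝ (En n) = 2 * n := by
  rw [finrank_real_of_complex]; simp

lemma nontrivial_En {n : ℕ} (hn : 1 ≤ n) : Nontrivial (En n) := by
  have : Nonempty (Fin n) := ⟨⟨0, hn⟩⟩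
  infer_instance

/-- surface measure viewed on the ambient space -/
def sig (n : ℕ) : Measure (En n) := (sphereM n).map Subtype.val

/-- total mass of the unnormalized surface measure -/
def cS (n : ℕ) : ℝ≥0∞ := ((volume : Measure (En n)).toSphere) Set.univ

lemma cS_ne_zero {n : ℕ} (hn : 1 ≤ n) : cS n ≠ 0 := by
  have := nontrivial_En hn
  simp only [cS, ne_eq, Measure.measure_univ_eq_zero]
  exact Measure.toSphere_ne_zero _

lemma cS_ne_top (n : ℕ) : cS n ≠ ∞ := measure_ne_top _ _

lemma measEmb_sphere (n : ℕ) : MeasurableEmbedding (Subtype.val : sphere (0 : En n) 1 → En n) :=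
  MeasurableEmbedding.subtype_coe isClosed_sphere.measurableSet

lemma lintegral_sig {n : ℕ} (φ : En n → ℝ≥0∞) :
    ∫⁻ ζ, φ ζ ∂(sig n) = ∫⁻ ζ : sphere (0 : En n) 1, φ ζ ∂(sphereM n) := by
  rw [sig, (measEmb_sphere n).lintegral_map]

lemma sig_univ {n : ℕ} (hn : 1 ≤ n) : sig n univ = 1 := by
  rw [sig, Measure.map_apply measurable_subtype_coe MeasurableSet.univ, preimage_univ, sphereM,
    Measure.smul_apply, smul_eq_mul]
  exact ENNReal.inv_mul_cancel (cS_ne_zero hn) (cS_ne_top n)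

lemma sig_prob {n : ℕ} (hn : 1 ≤ n) : IsProbabilityMeasure (sig n) := ⟨sig_univ hn⟩

instance sphereM_finite (n : ℕ) : SFinite (sphereM n) := by unfold sphereM; infer_instance
instance sig_sfinite (n : ℕ) : SFinite (sig n) := by unfold sig; infer_instance

lemma ae_sig_norm (n : ℕ) : ∀ᵐ ζ ∂(sig n), ‖ζ‖ = 1 := by
  rw [sig, (measEmb_sphere n).ae_map_iff]
  exact Filter.Eventually.of_forall fun ζ => by simp

lemma toSphere_eq {n : ℕ} (hn : 1 ≤ n) : (volume : Measure (En n)).toSphere = cS n • sphereM n := by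
  rw [sphereM, smul_smul]
  change _ = (cS n * (cS n)⁻¹) • _
  rw [ENNReal.mul_inv_cancel (cS_ne_zero hn) (cS_ne_top n), one_smul]

lemma polar {n : ℕ} (hn : 1 ≤ n) {h : En n → ℝ≥0∞} (hh : Measurable h) :
    ∫⁻ z, h z = cS n * ∫⁻ ζ, (∫⁻ r in Ioi (0:ℝ), h (r • ζ) * ENNReal.ofReal (r ^ (2 * n - 1))) ∂(sig n) := by
  have := nontrivial_En hn
  have h1 : ∫⁻ z, h z = ∫⁻ z : ({(0)}ᶜ : Set (En n)), h z ∂((volume : Measure (En n)).comap (↑)) := by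
    rw [lintegral_subtype_comap (measurableSet_singleton _).compl, restrict_compl_singleton]
  rw [h1]
  have h2 := (volume : Measure (En n)).measurePreserving_homeomorphUnitSphereProd
  have h3 : ∀ z : ({(0)}ᶜ : Set (En n)), h z =
      (fun p : sphere (0 : En n) 1 × Ioi (0:ℝ) => h (p.2.1 • p.1.1)) (homeomorphUnitSphereProd (En n) z) := by
    intro z
    simp only [homeomorphUnitSphereProd_apply_snd_coe, homeomorphUnitSphereProd_apply_fst_coe]
    congr 1
    rw [smul_smul, mul_inv_cancel₀, one_smul]
    exact norm_ne_zero_iff.2 z.2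
  simp_rw [h3]
  have hm : Measurable (fun p : sphere (0 : En n) 1 × Ioi (0:ℝ) => h (p.2.1 • p.1.1)) := by
    apply hh.comp
    have : Continuous (fun p : sphere (0 : En n) 1 × Ioi (0:ℝ) => p.2.1 • p.1.1) := by fun_prop
    exact this.measurable
  rw [h2.lintegral_comp hm, lintegral_prod _ hm.aemeasurable, toSphere_eq hn, lintegral_smul_measure,
    smul_eq_mul, lintegral_sig (fun ζ => ∫⁻ r in Ioi (0:ℝ), h (r • ζ) * ENNReal.ofReal (r ^ (2 * n - 1)))]
  congr 1
  apply lintegral_congr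
  intro ζ
  rw [Measure.volumeIoiPow, lintegral_withDensity_eq_lintegral_mul, finrank_En]
  · simp only [Pi.mul_apply]
    rw [lintegral_subtype_comap measurableSet_Ioi (fun r : ℝ => ENNReal.ofReal (r ^ (2 * n - 1)) * h (r • (ζ: En n)))]
    simp_rw [mul_comm]
  · fun_prop
  · apply hh.comp
    have : Continuous (fun p : Ioi (0:ℝ) => p.1 • ζ.1) := by fun_prop
    exact this.measurable

/-- multiplication by a unit complex number -/
def rotU {n : ℕ} (c : ℂ) (hc : ‖c‖ = 1) : En n ≃ₗᵢ[ℝ] En n :=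
  { LinearEquiv.smulOfNeZero ℂ (En n) c (by rintro rfl; simp at hc) |>.restrictScalars ℝ with
    norm_map' := fun x => by
      change ‖c • x‖ = ‖x‖
      rw [norm_smul, hc, one_mul] }

lemma rotU_apply {n : ℕ} (c : ℂ) (hc : ‖c‖ = 1) (x : En n) : rotU c hc x = c • x := rfl

lemma mp_rot_volume {n : ℕ} (c : ℂ) (hc : ‖c‖ = 1) :
    MeasurePreserving (fun x : En n => c • x) volume volume :=
  (rotU c hc).measurePreserving

lemma lintegral_rot_volume {n : ℕ} (c : ℂ) (hc : ‖c‖ = 1) (h : En n → ℝ≥0∞) :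
    ∫⁻ z, h (c • z) = ∫⁻ z, h z :=
  (mp_rot_volume c hc).lintegral_comp_emb (rotU c hc).toHomeomorph.measurableEmbedding h

lemma mp_rot_toSphere {n : ℕ} (c : ℂ) (hc : ‖c‖ = 1) (s : Set (En n)) (hs : MeasurableSet s) :
    (volume : Measure (En n)).toSphere (Subtype.val ⁻¹' ((fun x : En n => c • x) ⁻¹' s)) =
      (volume : Measure (En n)).toSphere (Subtype.val ⁻¹' s) := by
  have hmc : Measurable (fun x : En n => c • x) := (continuous_const_smul c).measurable
  rw [Measure.toSphere_apply' _ (measurable_subtype_coe (hmc hs)),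
    Measure.toSphere_apply' _ (measurable_subtype_coe hs)]
  congr 1
  symm
  rw [← (mp_rot_volume c hc).measure_preimage_emb (rotU c hc).toHomeomorph.measurableEmbedding]
  congr 1
  ext x
  simp only [mem_preimage, Set.mem_smul, mem_image, Subtype.exists, exists_and_left, exists_prop,
    exists_eq_right_right, mem_sphere_iff_norm, sub_zero]
  have hc0 : c ≠ 0 := by rintro rfl; simp at hc
  constructor
  · rintro ⟨r, hr, y, ⟨hy1, hy2⟩, hy3⟩
    refine ⟨r, hr, c⁻¹ • y, ⟨?_, ?_⟩, ?_⟩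
    · simpa [smul_smul, hc0] using hy1
    · rw [norm_smul, norm_inv, hc, inv_one, one_mul, hy2]
    · rw [smul_comm, hy3, smul_smul, inv_mul_cancel₀ hc0, one_smul]
  · rintro ⟨r, hr, y, ⟨hy1, hy2⟩, rfl⟩
    refine ⟨r, hr, c • y, ⟨hy1, ?_⟩, smul_comm r c y⟩
    rw [norm_smul, hc, one_mul, hy2]

lemma mp_rot_sig {n : ℕ} (c : ℂ) (hc : ‖c‖ = 1) :
    MeasurePreserving (fun x : En n => c • x) (sig n) (sig n) := by
  have hmc : Measurable (fun x : En n => c • x) := (continuous_const_smul c).measurable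
  refine ⟨hmc, ?_⟩
  ext s hs
  rw [Measure.map_apply hmc hs, sig, Measure.map_apply measurable_subtype_coe (hmc hs),
    Measure.map_apply measurable_subtype_coe hs, sphereM, Measure.smul_apply, Measure.smul_apply,
    mp_rot_toSphere c hc s hs]

lemma lintegral_rot_sig {n : ℕ} (c : ℂ) (hc : ‖c‖ = 1) (h : En n → ℝ≥0∞) :
    ∫⁻ z, h (c • z) ∂(sig n) = ∫⁻ z, h z ∂(sig n) :=
  (mp_rot_sig c hc).lintegral_comp_emb (rotU c hc).toHomeomorph.measurableEmbedding h


lemma herm_eq {n : ℕ} (z w : En n) : herm z w = inner ℂ w z := by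
  simp [herm, PiLp.inner_apply]

lemma herm_comm {n : ℕ} (z w : En n) : ‖1 - herm z w‖ = ‖1 - herm w z‖ := by
  rw [herm_eq, herm_eq, ← Complex.norm_conj]
  simp

/-- nonisotropic box -/
def box {n : ℕ} (e : En n) (t : ℝ) : Set (En n) := {u | ‖herm u e‖ < t ^ 2 ∧ ‖u‖ < t}

lemma measurable_herm_left {n : ℕ} (e : En n) : Continuous (fun u : En n => herm u e) := by
  simp_rw [herm_eq]; fun_prop

lemma box_open {n : ℕ} (e : En n) (t : ℝ) : IsOpen (box e t) := by
  apply IsOpen.inter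
  · exact isOpen_lt (measurable_herm_left e).norm continuous_const
  · exact isOpen_lt continuous_norm continuous_const

/-- nonisotropic dilation -/
def dilL {n : ℕ} (e : En n) (t : ℝ) : En n →ₗ[ℂ] En n :=
  (t : ℂ) • LinearMap.transvection (innerSL ℂ e).toLinearMap (((t - 1 : ℝ) : ℂ) • e)

lemma dilL_apply {n : ℕ} (e : En n) (t : ℝ) (w : En n) :
    dilL e t w = (t : ℂ) • (w + (((t - 1 : ℝ) : ℂ) * herm w e) • e) := by
  simp only [dilL, LinearMap.smul_apply, LinearMap.transvection.apply, herm_eq]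
  rw [smul_smul, mul_comm (((t - 1 : ℝ) : ℂ))]
  rfl

lemma dilL_det {n : ℕ} (e : En n) (he : ‖e‖ = 1) (t : ℝ) (ht : 0 ≤ t) :
    |LinearMap.det ((dilL e t).restrictScalars ℝ)| = (t ^ 2) ^ (n + 1) := by
  have h1 : LinearMap.det (dilL e t) = (t : ℂ) ^ (n + 1) := by
    rw [dilL, LinearMap.det_smul, LinearMap.transvection.det]
    simp only [finrank_euclideanSpace, Fintype.card_fin]
    have : (innerSL ℂ e).toLinearMap (((t - 1 : ℝ) : ℂ) • e) = ((t - 1 : ℝ) : ℂ) := by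
      change inner ℂ e _ = _
      rw [inner_smul_right, inner_self_eq_norm_sq_to_K, he]
      simp
    rw [this]
    push_cast
    ring
  rw [LinearMap.det_restrictScalars, h1, Algebra.norm_complex_eq]
  rw [show ((t : ℂ) ^ (n + 1)) = ((t ^ (n + 1) : ℝ) : ℂ) by push_cast; rfl]
  change |Complex.normSq _| = _
  rw [Complex.normSq_ofReal, abs_of_nonneg (by positivity)]
  ring

lemma norm_add_e {n : ℕ} (e : En n) (he : ‖e‖ = 1) (w : En n) (b : ℝ) :
    ‖w + ((b : ℂ) * herm w e) • e‖ ^ 2 = ‖w‖ ^ 2 + (2 * b + b ^ 2) * ‖herm w e‖ ^ 2 := by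
  rw [@norm_add_sq ℂ, norm_smul, he, inner_smul_right, norm_mul, ← inner_conj_symm, ← herm_eq,
    mul_assoc, Complex.mul_conj, Complex.normSq_eq_norm_sq]
  have : RCLike.re ((b : ℂ) * ((‖herm w e‖ ^ 2 : ℝ) : ℂ)) = b * ‖herm w e‖ ^ 2 := by
    rw [← Complex.ofReal_mul]; exact Complex.ofReal_re _
  rw [this, Complex.norm_real, mul_one, mul_pow, Real.norm_eq_abs, sq_abs]
  ring

lemma herm_dilL {n : ℕ} (e : En n) (he : ‖e‖ = 1) (w : En n) (b : ℝ) :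
    herm (w + ((b : ℂ) * herm w e) • e) e = (1 + b) * herm w e := by
  rw [herm_eq, inner_add_right, inner_smul_right, inner_self_eq_norm_sq_to_K, he, ← herm_eq]
  simp
  ring

lemma herm_le {n : ℕ} (z w : En n) : ‖herm z w‖ ≤ ‖z‖ * ‖w‖ := by
  rw [herm_eq, mul_comm]; exact norm_inner_le_norm _ _

lemma herm_smul_left {n : ℕ} (c : ℂ) (z w : En n) : herm (c • z) w = c * herm z w := by
  rw [herm_eq, herm_eq, inner_smul_right]

lemma box_lower {n : ℕ} (e : En n) (he : ‖e‖ = 1) (t : ℝ) (ht : 0 < t) (ht1 : t ≤ 1) :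
    ENNReal.ofReal ((t ^ 2) ^ (n + 1)) * volume (ball (0 : En n) 1) ≤ volume (box e t) := by
  rw [← dilL_det e he t ht.le, ← Measure.addHaar_image_linearMap]
  apply measure_mono
  rintro _ ⟨w, hw, rfl⟩
  rw [mem_ball_zero_iff] at hw
  have hh := herm_le w e
  rw [he, mul_one] at hh
  change dilL e t w ∈ _
  rw [dilL_apply]
  constructor
  · rw [herm_smul_left, herm_dilL e he, norm_mul, norm_mul]
    have : ‖(1 + ((t - 1 : ℝ) : ℂ))‖ = t := by
      push_cast; simp [abs_of_pos ht]
    rw [this, Complex.norm_real, Real.norm_eq_abs, abs_of_pos ht]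
    nlinarith [mul_pos ht ht]
  · rw [norm_smul, Complex.norm_real, Real.norm_eq_abs, abs_of_pos ht]
    have h1 := norm_add_e e he w (t - 1)
    have h2 : ‖w + (((t - 1 : ℝ) : ℂ) * herm w e) • e‖ < 1 := by
      apply lt_of_pow_lt_pow_left₀ 2 zero_le_one
      rw [h1, one_pow]
      have : (2 * (t - 1) + (t - 1) ^ 2) * ‖herm w e‖ ^ 2 ≤ 0 := by
        apply mul_nonpos_of_nonpos_of_nonneg _ (by positivity)
        nlinarith
      nlinarith [norm_nonneg w]
    nlinarith

lemma box_upper {n : ℕ} (e : En n) (he : ‖e‖ = 1) (t : ℝ) (ht : 0 < t) :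
    volume (box e t) ≤ ENNReal.ofReal ((t ^ 2) ^ (n + 1)) * volume (ball (0 : En n) 2) := by
  rw [← dilL_det e he t ht.le, ← Measure.addHaar_image_linearMap]
  apply measure_mono
  intro u hu
  obtain ⟨h1, h2⟩ := hu
  have ht0 : (t : ℂ) ≠ 0 := by exact_mod_cast ht.ne'
  set w : En n := ((t⁻¹ : ℝ) : ℂ) • u + (((t⁻¹ - 1 : ℝ) : ℂ) * herm (((t⁻¹ : ℝ) : ℂ) • u) e) • e with hw
  have hwh : herm w e = ((t⁻¹ : ℝ) : ℂ) * (((t⁻¹ : ℝ) : ℂ) * herm u e) := by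
    rw [hw, herm_dilL e he, herm_smul_left]; push_cast; ring
  refine ⟨w, ?_, ?_⟩
  · rw [mem_ball_zero_iff]
    apply lt_of_pow_lt_pow_left₀ 2 zero_le_two
    rw [hw, norm_add_e e he, herm_smul_left, norm_smul, norm_mul, Complex.norm_real, Real.norm_eq_abs,
      abs_of_pos (inv_pos.2 ht)]
    have h3 : t⁻¹ * ‖u‖ < 1 := by rw [inv_mul_eq_div, div_lt_one ht]; exact h2
    have h4 : t⁻¹ * (t⁻¹ * ‖herm u e‖) < 1 := by
      rw [inv_mul_eq_div, inv_mul_eq_div, div_div, div_lt_one (by positivity)]; nlinarith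
    have h5 : (2 * (t⁻¹ - 1) + (t⁻¹ - 1) ^ 2) * (t⁻¹ * ‖herm u e‖) ^ 2
      = (t⁻¹ * (t⁻¹ * ‖herm u e‖)) ^ 2 - (t⁻¹ * ‖herm u e‖) ^ 2 := by ring
    rw [h5]
    have h6 : 0 ≤ t⁻¹ * ‖u‖ := by positivity
    have h7 : 0 ≤ t⁻¹ * (t⁻¹ * ‖herm u e‖) := by positivity
    nlinarith [sq_nonneg (t⁻¹ * ‖herm u e‖)]
  · change dilL e t w = u
    rw [dilL_apply, hwh, hw, herm_smul_left]
    have : (t : ℂ) • (((t⁻¹ : ℝ) : ℂ) • u + (((t⁻¹ - 1 : ℝ) : ℂ) * (((t⁻¹ : ℝ) : ℂ) * herm u e)) • e +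
        (((t - 1 : ℝ) : ℂ) * (((t⁻¹ : ℝ) : ℂ) * (((t⁻¹ : ℝ) : ℂ) * herm u e))) • e) =
        ((t : ℂ) * ((t⁻¹ : ℝ) : ℂ)) • u + ((t : ℂ) * ((((t⁻¹ - 1 : ℝ) : ℂ) * (((t⁻¹ : ℝ) : ℂ) * herm u e)) +
          (((t - 1 : ℝ) : ℂ) * (((t⁻¹ : ℝ) : ℂ) * (((t⁻¹ : ℝ) : ℂ) * herm u e))))) • e := by
      module
    rw [this]
    have h8 : (t : ℂ) * ((t⁻¹ : ℝ) : ℂ) = 1 := by push_cast; field_simp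
    have h9 : (t : ℂ) * ((((t⁻¹ - 1 : ℝ) : ℂ) * (((t⁻¹ : ℝ) : ℂ) * herm u e)) +
          (((t - 1 : ℝ) : ℂ) * (((t⁻¹ : ℝ) : ℂ) * (((t⁻¹ : ℝ) : ℂ) * herm u e)))) = 0 := by
      push_cast; field_simp; ring
    rw [h8, h9]; simp


/-- nonnegative continuous functions with the circular sub-mean value property in the unit ball -/
structure SubM {n : ℕ} (G : En n → ℝ) : Prop where
  cont : Continuous G
  nonneg : ∀ z, 0 ≤ G z
  sub : ∀ z w : En n, (∀ l : ℂ, ‖l‖ ≤ 1 → ‖z + l • w‖ ≤ 1) →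
    ENNReal.ofReal (2 * Real.pi) * ENNReal.ofReal (G z) ≤
      ∫⁻ θ in Ioc (0:ℝ) (2 * Real.pi), ENNReal.ofReal (G (z + Complex.exp (θ * I) • w))

/-- radial retraction to the closed unit ball -/
def retr {n : ℕ} (z : En n) : En n := (max 1 ‖z‖)⁻¹ • z

lemma retr_cont (n : ℕ) : Continuous (retr : En n → En n) := by
  unfold retr
  refine Continuous.fun_smul (Continuous.inv₀ (by fun_prop) ?_) continuous_id
  intro x
  have : 1 ≤ max 1 ‖x‖ := le_max_left _ _
  positivity

lemma retr_norm {n : ℕ} (z : En n) : ‖retr z‖ ≤ 1 := by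
  unfold retr
  have : 1 ≤ max 1 ‖z‖ := le_max_left _ _
  rw [norm_smul, Real.norm_eq_abs, abs_of_pos (by positivity), inv_mul_eq_div,
    div_le_one (by positivity)]
  exact le_max_right _ _

lemma retr_eq {n : ℕ} {z : En n} (hz : ‖z‖ ≤ 1) : retr z = z := by
  unfold retr
  rw [max_eq_left hz]; simp

lemma subM_of_diff {n : ℕ} {F : En n → l2} {R : ℝ} (hR : 1 < R)
    (hF : DifferentiableOn ℂ F (ball 0 R)) : SubM (fun z => √‖F (retr z)‖) where
  cont := by
    have h1 : Continuous (fun z : En n => F (retr z)) := by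
      rw [← continuousOn_univ]
      apply hF.continuousOn.comp (retr_cont n).continuousOn
      intro z _
      rw [mem_ball_zero_iff]
      exact (retr_norm z).trans_lt hR
    exact h1.norm.sqrt
  nonneg := fun z => Real.sqrt_nonneg _
  sub := by
    intro z w hzw
    set R' : ℝ := 1 + (R - 1) / (1 + ‖w‖) with hR'
    have hw : 0 < 1 + ‖w‖ := by positivity
    have h1 : 1 < R' := by
      have : 0 < (R - 1) / (1 + ‖w‖) := div_pos (by linarith) hw
      linarith
    have hd : DifferentiableOn ℂ (fun l : ℂ => F (z + l • w)) (ball 0 R') := by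
      apply hF.comp (by fun_prop)
      intro l hl
      rw [mem_ball_zero_iff] at hl ⊢
      by_cases hl1 : ‖l‖ ≤ 1
      · exact (hzw l hl1).trans_lt hR
      push Not at hl1
      set l' : ℂ := l / ‖l‖ with hl'
      have hl0 : (‖l‖ : ℂ) ≠ 0 := by
        have : ‖l‖ ≠ 0 := by linarith
        exact_mod_cast this
      have h2 : ‖l'‖ = 1 := by
        rw [hl', norm_div]; simp
        exact fun h => by simp [h] at hl0
      have h3 : l = l' + (‖l‖ - 1 : ℝ) * l' := by
        rw [hl']; push_cast; field_simp; ring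
      have h4 : z + l • w = (z + l' • w) + (((‖l‖ - 1 : ℝ) : ℂ) * l') • w := by
        conv_lhs => rw [h3]
        module
      change ‖z + l • w‖ < R
      rw [h4]
      calc _ ≤ ‖z + l' • w‖ + ‖(((‖l‖ - 1 : ℝ) : ℂ) * l') • w‖ := norm_add_le _ _
        _ ≤ 1 + (‖l‖ - 1) * ‖w‖ := by
          rw [norm_smul, norm_mul, h2, Complex.norm_real, Real.norm_eq_abs,
            abs_of_pos (by linarith)]
          have := hzw l' h2.le
          linarith
        _ < R := by
          have h5 : ‖l‖ - 1 < (R - 1) / (1 + ‖w‖) := by rw [hR'] at hl; linarith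
          rw [lt_div_iff₀ hw] at h5
          nlinarith
    have := submean_l2 h1 hd
    simp only [zero_smul, add_zero] at this
    have hz1 : ‖z‖ ≤ 1 := by simpa using hzw 0 (by simp)
    rw [retr_eq hz1]
    refine this.trans (le_of_eq ?_)
    apply lintegral_congr
    intro θ
    rw [retr_eq]
    apply hzw
    rw [Complex.norm_exp_ofReal_mul_I]

section mono
variable {n : ℕ} {G : En n → ℝ}

/-- spherical mean -/
def sMean (G : En n → ℝ) (l : ℂ) : ℝ := ∫ ζ in closedBall (0 : En n) 1, G (l • ζ) ∂(sig n)

lemma sig_restrict (n : ℕ) : (sig n).restrict (closedBall (0 : En n) 1) = sig n := by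
  apply Measure.restrict_eq_self_of_ae_mem
  filter_upwards [ae_sig_norm n] with ζ hζ
  rw [mem_closedBall_zero_iff, hζ]

lemma sMean_cont (hn : 1 ≤ n) (hG : SubM G) : Continuous (sMean G) := by
  have := sig_prob hn
  have := hG.cont
  apply continuous_parametric_integral_of_continuous _ (isCompact_closedBall _ _)
  fun_prop

lemma ofReal_sMean (hn : 1 ≤ n) (hG : SubM G) (l : ℂ) :
    ENNReal.ofReal (sMean G l) = ∫⁻ ζ, ENNReal.ofReal (G (l • ζ)) ∂(sig n) := by
  have := sig_prob hn
  have h1 := hG.cont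
  rw [sMean, ofReal_integral_eq_lintegral_ofReal, sig_restrict]
  · apply ContinuousOn.integrableOn_compact (isCompact_closedBall _ _)
    fun_prop
  · exact Filter.Eventually.of_forall fun _ => hG.nonneg _

lemma sMean_nonneg (hG : SubM G) (l : ℂ) : 0 ≤ sMean G l :=
  integral_nonneg fun _ => hG.nonneg _

lemma sMean_rot (hn : 1 ≤ n) (hG : SubM G) (l : ℂ) : sMean G l = sMean G (‖l‖ : ℂ) := by
  have h : ENNReal.ofReal (sMean G l) = ENNReal.ofReal (sMean G (‖l‖ : ℂ)) := by
    rw [ofReal_sMean hn hG, ofReal_sMean hn hG]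
    by_cases hl : l = 0
    · simp [hl]
    have hl0 : (‖l‖ : ℂ) ≠ 0 := by simpa using hl
    rw [← lintegral_rot_sig (l / ‖l‖) (by simp [hl]) (fun ζ => ENNReal.ofReal (G ((‖l‖ : ℂ) • ζ)))]
    simp_rw [smul_smul]
    rw [mul_div_cancel₀ _ hl0]
  rwa [ENNReal.ofReal_eq_ofReal_iff (sMean_nonneg hG _) (sMean_nonneg hG _)] at h

lemma sMean_sub (hn : 1 ≤ n) (hG : SubM G) (a r : ℝ) (ha : 0 ≤ a) (hr : 0 ≤ r) (har : a + r ≤ 1) :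
    2 * Real.pi * sMean G a ≤ ∫ θ in (0:ℝ)..(2 * Real.pi), sMean G (a + Complex.exp (θ * I) * r) := by
  have hpi : 0 < 2 * Real.pi := Real.two_pi_pos
  have hc := sMean_cont hn hG
  have hGc := hG.cont
  rw [intervalIntegral.integral_of_le hpi.le]
  rw [← ENNReal.ofReal_le_ofReal_iff (integral_nonneg fun _ => sMean_nonneg hG _),
    ENNReal.ofReal_mul hpi.le, ofReal_integral_eq_lintegral_ofReal]
  · simp_rw [ofReal_sMean hn hG]
    rw [lintegral_lintegral_swap, ← lintegral_const_mul']
    · apply lintegral_mono_ae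
      filter_upwards [ae_sig_norm n] with ζ hζ
      have := hG.sub ((a : ℂ) • ζ) ((r : ℂ) • ζ) ?_
      · simpa only [add_smul, mul_smul] using this
      · intro l hl
        rw [smul_smul, ← add_smul, norm_smul, hζ, mul_one]
        refine (norm_add_le _ _).trans ?_
        rw [norm_mul, Complex.norm_real, Complex.norm_real, Real.norm_eq_abs, Real.norm_eq_abs,
          abs_of_nonneg ha, abs_of_nonneg hr]
        nlinarith
    · exact ENNReal.ofReal_ne_top
    · apply Measurable.aemeasurable
      apply Continuous.measurable
      apply ENNReal.continuous_ofReal.comp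
      apply hGc.comp
      fun_prop
  · have : Continuous (fun θ : ℝ => sMean G (a + Complex.exp (θ * I) * r)) := by fun_prop
    exact (this.integrableOn_Ioc)
  · exact Filter.Eventually.of_forall fun _ => sMean_nonneg hG _

lemma sMean_mono (hn : 1 ≤ n) (hG : SubM G) (ρ : ℝ) (h0 : 0 ≤ ρ) (h1 : ρ ≤ 1) :
    sMean G ρ ≤ sMean G 1 := by
  have hc := sMean_cont hn hG
  have hpi : 0 < 2 * Real.pi := Real.two_pi_pos
  have hφ : Continuous (fun x : ℝ => sMean G (x : ℂ)) := by fun_prop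
  obtain ⟨x0, hx0, hx0m⟩ := (isCompact_Icc (a := (0:ℝ)) (b := 1)).exists_isMaxOn
    ⟨0, by simp⟩ hφ.continuousOn
  set Mx := sMean G (x0 : ℂ) with hMx
  have hS : IsCompact (Icc (0:ℝ) 1 ∩ {x : ℝ | sMean G (x : ℂ) = Mx}) :=
    isCompact_Icc.inter_right (isClosed_eq hφ continuous_const)
  obtain ⟨ρ0, ⟨⟨hρ0, hρ1⟩, hρM⟩, hgr⟩ := hS.exists_isGreatest ⟨x0, hx0, rfl⟩
  change sMean G (ρ0 : ℂ) = Mx at hρM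
  have hall : ∀ x ∈ Icc (0:ℝ) 1, sMean G (x : ℂ) ≤ Mx := fun x hx => hx0m hx
  rcases eq_or_lt_of_le hρ1 with h | h
  · have := hall ρ ⟨h0, h1⟩
    rw [← hρM, h] at this
    simpa using this
  · exfalso
    set r := 1 - ρ0 with hr
    have hrp : 0 < r := by linarith
    have hsub := sMean_sub hn hG ρ0 r hρ0 hrp.le (by linarith)
    rw [hρM] at hsub
    have hlt : ∫ θ in (0:ℝ)..(2 * Real.pi), sMean G (ρ0 + Complex.exp (θ * I) * r) <
        ∫ θ in (0:ℝ)..(2 * Real.pi), Mx := by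
      apply intervalIntegral.integral_lt_integral_of_continuousOn_of_le_of_exists_lt hpi
      · fun_prop
      · fun_prop
      · intro θ _
        rw [sMean_rot hn hG]
        apply hall
        refine ⟨norm_nonneg _, (norm_add_le _ _).trans ?_⟩
        rw [norm_mul, Complex.norm_exp_ofReal_mul_I, Complex.norm_real, Complex.norm_real,
          Real.norm_eq_abs, Real.norm_eq_abs, abs_of_nonneg hρ0, abs_of_pos hrp]
        linarith
      · refine ⟨0, ⟨le_rfl, hpi.le⟩, ?_⟩
        have h2 : (ρ0 : ℂ) + Complex.exp ((0:ℝ) * I) * r = ((1 : ℝ) : ℂ) := by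
          rw [hr]; push_cast; simp
        rw [h2]
        apply lt_of_le_of_ne (hall 1 ⟨zero_le_one, le_rfl⟩)
        intro h3
        have := hgr ⟨⟨zero_le_one, le_rfl⟩, h3⟩
        linarith
    rw [intervalIntegral.integral_const, smul_eq_mul, sub_zero] at hlt
    linarith

lemma lmean_mono (hn : 1 ≤ n) (hG : SubM G) (ρ : ℝ) (h0 : 0 ≤ ρ) (h1 : ρ ≤ 1) :
    ∫⁻ ζ, ENNReal.ofReal (G (ρ • ζ)) ∂(sig n) ≤ ∫⁻ ζ, ENNReal.ofReal (G ζ) ∂(sig n) := by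
  have := ENNReal.ofReal_le_ofReal (sMean_mono hn hG ρ h0 h1)
  rw [ofReal_sMean hn hG, ofReal_sMean hn hG] at this
  simpa using this
end mono


lemma exists_unit {n : ℕ} (hn : 1 ≤ n) (z : En n) : ∃ e : En n, ‖e‖ = 1 ∧ z = (‖z‖ : ℂ) • e := by
  have := nontrivial_En hn
  by_cases hz : z = 0
  · obtain ⟨e, he⟩ := exists_norm_eq (En n) (zero_le_one' ℝ)
    exact ⟨e, he, by simp [hz]⟩
  · have hz0 : (‖z‖ : ℂ) ≠ 0 := by simpa using hz
    refine ⟨((‖z‖ : ℂ)⁻¹) • z, ?_, ?_⟩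
    · rw [norm_smul, norm_inv, Complex.norm_real, norm_norm, inv_mul_cancel₀ (norm_ne_zero_iff.2 hz)]
    · rw [smul_smul, mul_inv_cancel₀ hz0, one_smul]

lemma box_smul {n : ℕ} (e : En n) (t : ℝ) (l : ℂ) (hl : ‖l‖ ≤ 1) {u : En n} (hu : u ∈ box e t) :
    l • u ∈ box e t := by
  obtain ⟨h1, h2⟩ := hu
  constructor
  · rw [herm_smul_left, norm_mul]
    nlinarith [norm_nonneg (herm u e), norm_nonneg l]
  · rw [norm_smul]
    nlinarith [norm_nonneg u, norm_nonneg l]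

lemma box_smul_iff {n : ℕ} (e : En n) (t : ℝ) (l : ℂ) (hl : ‖l‖ = 1) (u : En n) :
    l • u ∈ box e t ↔ u ∈ box e t := by
  refine ⟨fun h => ?_, fun h => box_smul e t l hl.le h⟩
  have := box_smul e t l⁻¹ (by rw [norm_inv, hl, inv_one]) h
  rwa [smul_smul, inv_mul_cancel₀ (by rintro rfl; simp at hl), one_smul] at this

lemma norm_sq_add_box {n : ℕ} {e : En n} (a : ℝ) (ha : 0 ≤ a) (he : ‖e‖ = 1) (u : En n) :
    ‖(a : ℂ) • e + u‖ ^ 2 ≤ a ^ 2 + 2 * a * ‖herm u e‖ + ‖u‖ ^ 2 := by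
  rw [@norm_add_sq ℂ, norm_smul, he, Complex.norm_real, Real.norm_eq_abs, abs_of_nonneg ha, mul_one,
    inner_smul_left]
  have h1 : RCLike.re ((starRingEnd ℂ) (a : ℂ) * inner ℂ e u) ≤ a * ‖herm u e‖ := by
    refine (RCLike.re_le_norm _).trans ?_
    rw [norm_mul, herm_eq]
    simp [abs_of_nonneg ha]
  nlinarith

lemma norm_add_box_lower {n : ℕ} {e : En n} (a : ℝ) (ha : 0 ≤ a) (he : ‖e‖ = 1) (u : En n) :
    a - ‖herm u e‖ ≤ ‖(a : ℂ) • e + u‖ := by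
  have h1 := herm_le ((a : ℂ) • e + u) e
  rw [he, mul_one] at h1
  have h2 : herm ((a : ℂ) • e + u) e = a + herm u e := by
    rw [herm_eq, inner_add_right, inner_smul_right, inner_self_eq_norm_sq_to_K, he, ← herm_eq]
    simp
  rw [h2] at h1
  have h3 := norm_sub_le_norm_add (a : ℂ) (herm u e)
  rw [Complex.norm_real, Real.norm_eq_abs, abs_of_nonneg ha] at h3
  linarith

lemma box_sub_mean {n : ℕ} {G : En n → ℝ} (hG : SubM G) (z e : En n) (t : ℝ)
    (hb : ∀ u ∈ box e t, ‖z + u‖ ≤ 1) :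
    ENNReal.ofReal (G z) * volume (box e t) ≤ ∫⁻ u in box e t, ENNReal.ofReal (G (z + u)) := by
  have hpi : 0 < 2 * Real.pi := Real.two_pi_pos
  have hGc := hG.cont
  have hmb := (box_open e t).measurableSet
  have h1 : ENNReal.ofReal (2 * Real.pi) * (ENNReal.ofReal (G z) * volume (box e t)) ≤
      ∫⁻ u in box e t, ∫⁻ θ in Ioc (0:ℝ) (2 * Real.pi),
        ENNReal.ofReal (G (z + Complex.exp (θ * I) • u)) := by
    rw [← mul_assoc, ← setLIntegral_const]
    apply setLIntegral_mono' hmb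
    intro u hu
    apply hG.sub
    intro l hl
    exact hb _ (box_smul e t l hl hu)
  rw [lintegral_lintegral_swap] at h1
  · have h2 : ∀ θ : ℝ, ∫⁻ u in box e t, ENNReal.ofReal (G (z + Complex.exp (θ * I) • u)) =
        ∫⁻ u in box e t, ENNReal.ofReal (G (z + u)) := by
      intro θ
      have hc : ‖Complex.exp (θ * I)‖ = 1 := Complex.norm_exp_ofReal_mul_I θ
      rw [← lintegral_indicator hmb, ← lintegral_indicator hmb,
        ← lintegral_rot_volume (Complex.exp (θ * I)) hc ((box e t).indicator fun u => ENNReal.ofReal (G (z + u)))]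
      apply lintegral_congr
      intro u
      by_cases hu : u ∈ box e t
      · rw [indicator_of_mem hu, indicator_of_mem ((box_smul_iff e t _ hc u).2 hu)]
      · rw [indicator_of_notMem hu, indicator_of_notMem (fun h => hu ((box_smul_iff e t _ hc u).1 h))]
    simp_rw [h2] at h1
    rw [setLIntegral_const, Real.volume_Ioc, sub_zero, mul_comm _ (ENNReal.ofReal (2 * Real.pi))] at h1
    exact (ENNReal.mul_le_mul_iff_right (by simpa using Real.pi_pos) ENNReal.ofReal_ne_top).1 h1
  · apply Measurable.aemeasurable
    apply Continuous.measurable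
    apply ENNReal.continuous_ofReal.comp
    apply hGc.comp
    fun_prop

lemma shell_bound {n : ℕ} (hn : 1 ≤ n) {G : En n → ℝ} (hG : SubM G) (a : ℝ) :
    ∫⁻ v in {v : En n | a < ‖v‖ ∧ ‖v‖ < 1}, ENNReal.ofReal (G v) ≤
      cS n * (ENNReal.ofReal (1 - a) * ∫⁻ ζ, ENNReal.ofReal (G ζ) ∂(sig n)) := by
  have hGc := hG.cont
  have hms : MeasurableSet {v : En n | a < ‖v‖ ∧ ‖v‖ < 1} :=
    ((isOpen_lt continuous_const continuous_norm).inter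
      (isOpen_lt continuous_norm continuous_const)).measurableSet
  have hGm : Measurable (fun v : En n => ENNReal.ofReal (G v)) := by fun_prop
  rw [← lintegral_indicator hms, polar hn (hGm.indicator hms)]
  gcongr
  calc _ ≤ ∫⁻ ζ, (∫⁻ r in Ioo a 1 ∩ Ioi 0, ENNReal.ofReal (G (r • ζ))) ∂(sig n) := by
        apply lintegral_mono_ae
        filter_upwards [ae_sig_norm n] with ζ hζ
        rw [← lintegral_indicator measurableSet_Ioi, ← lintegral_indicator (measurableSet_Ioo.inter measurableSet_Ioi)]
        apply lintegral_mono
        intro r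
        by_cases hr : 0 < r
        · rw [indicator_of_mem (by exact hr)]
          have hnr : ‖r • ζ‖ = r := by rw [norm_smul, hζ, mul_one, Real.norm_eq_abs, abs_of_pos hr]
          by_cases hr2 : a < r ∧ r < 1
          · rw [indicator_of_mem (show r ∈ Ioo a 1 ∩ Ioi 0 from ⟨hr2, hr⟩), indicator_of_mem
              (show r • ζ ∈ {v : En n | a < ‖v‖ ∧ ‖v‖ < 1} by
                change a < ‖r • ζ‖ ∧ ‖r • ζ‖ < 1
                rw [hnr]; exact hr2)]
            calc _ ≤ ENNReal.ofReal (G (r • ζ)) * 1 := by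
                  gcongr
                  rw [ENNReal.ofReal_le_one]
                  exact pow_le_one₀ hr.le hr2.2.le
              _ = _ := mul_one _
          · rw [indicator_of_notMem (fun h => hr2 ?_)]
            · simp
            · change a < ‖r • ζ‖ ∧ ‖r • ζ‖ < 1 at h
              rwa [hnr] at h
        · rw [indicator_of_notMem (by exact hr)]
          exact zero_le
    _ = ∫⁻ r in Ioo a 1 ∩ Ioi 0, (∫⁻ ζ, ENNReal.ofReal (G (r • ζ)) ∂(sig n)) := by
        rw [lintegral_lintegral_swap]
        apply Measurable.aemeasurable
        apply Continuous.measurable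
        apply ENNReal.continuous_ofReal.comp
        apply hGc.comp
        fun_prop
    _ ≤ ∫⁻ r in Ioo a 1 ∩ Ioi 0, (∫⁻ ζ, ENNReal.ofReal (G ζ) ∂(sig n)) := by
        apply setLIntegral_mono' (measurableSet_Ioo.inter measurableSet_Ioi)
        intro r hr
        exact lmean_mono hn hG r (le_of_lt hr.2) hr.1.2.le
    _ ≤ _ := by
        rw [setLIntegral_const, mul_comm]
        gcongr
        calc volume (Ioo a 1 ∩ Ioi 0) ≤ volume (Ioo a 1) := measure_mono inter_subset_left
          _ = _ := Real.volume_Ioo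

lemma vol_ball_ne_zero (n : ℕ) (r : ℝ) (hr : 0 < r) : volume (ball (0 : En n) r) ≠ 0 :=
  (measure_ball_pos _ _ hr).ne'

lemma point_eval {n : ℕ} (hn : 1 ≤ n) : ∃ C : ℝ≥0∞, C ≠ ∞ ∧ ∀ G : En n → ℝ, SubM G →
    ∀ z : En n, ‖z‖ < 1 → ENNReal.ofReal ((1 - ‖z‖) ^ n) * ENNReal.ofReal (G z) ≤
      C * ∫⁻ ζ, ENNReal.ofReal (G ζ) ∂(sig n) := by
  set Vb := volume (ball (0 : En n) 1) with hVb
  have hV0 : Vb ≠ 0 := vol_ball_ne_zero n 1 one_pos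
  have hVt : Vb ≠ ∞ := measure_ball_lt_top.ne
  refine ⟨ENNReal.ofReal (2 * 8 ^ (n + 1)) * cS n * Vb⁻¹, ?_, ?_⟩
  · exact ENNReal.mul_ne_top (ENNReal.mul_ne_top ENNReal.ofReal_ne_top (cS_ne_top n))
      (ENNReal.inv_ne_top.2 hV0)
  intro G hG z hz
  obtain ⟨e, he, hze⟩ := exists_unit hn z
  set a := ‖z‖ with ha
  have ha0 : 0 ≤ a := norm_nonneg _
  set δ := 1 - a with hδ
  have hδp : 0 < δ := by linarith
  set t := √(δ / 8) with ht
  have ht2 : t ^ 2 = δ / 8 := Real.sq_sqrt (by positivity)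
  have htp : 0 < t := Real.sqrt_pos.2 (by positivity)
  have ht1 : t ≤ 1 := by
    have : t ^ 2 ≤ 1 := by rw [ht2]; linarith
    nlinarith
  have hb : ∀ u ∈ box e t, 1 - 2 * δ < ‖z + u‖ ∧ ‖z + u‖ < 1 := by
    rintro u ⟨h1, h2⟩
    rw [hze]
    have h3 := norm_sq_add_box a ha0 he u
    have h4 := norm_add_box_lower a ha0 he u
    refine ⟨by linarith, ?_⟩
    apply lt_of_pow_lt_pow_left₀ 2 zero_le_one
    have h5 : ‖u‖ ^ 2 < t ^ 2 := by gcongr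
    nlinarith [norm_nonneg (herm u e)]
  have h1 := box_sub_mean hG z e t (fun u hu => (hb u hu).2.le)
  have h2 : ∫⁻ u in box e t, ENNReal.ofReal (G (z + u)) ≤
      ∫⁻ v in {v : En n | 1 - 2 * δ < ‖v‖ ∧ ‖v‖ < 1}, ENNReal.ofReal (G v) := by
    have hms : MeasurableSet {v : En n | 1 - 2 * δ < ‖v‖ ∧ ‖v‖ < 1} :=
      ((isOpen_lt continuous_const continuous_norm).inter
        (isOpen_lt continuous_norm continuous_const)).measurableSet
    rw [← lintegral_indicator hms, ← lintegral_indicator (box_open e t).measurableSet,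
      ← lintegral_add_left_eq_self ({v : En n | 1 - 2 * δ < ‖v‖ ∧ ‖v‖ < 1}.indicator
        fun v => ENNReal.ofReal (G v)) z]
    apply lintegral_mono
    intro u
    beta_reduce
    by_cases hu : u ∈ box e t
    · rw [indicator_of_mem hu, indicator_of_mem]
      exact hb u hu
    · rw [indicator_of_notMem hu]; exact zero_le
  have h3 := shell_bound hn hG (1 - 2 * δ)
  have h4 := box_lower e he t htp ht1
  set Iσ := ∫⁻ ζ, ENNReal.ofReal (G ζ) ∂(sig n)
  have h5 : ENNReal.ofReal (G z) * (ENNReal.ofReal ((δ / 8) ^ (n + 1)) * Vb) ≤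
      cS n * (ENNReal.ofReal (2 * δ) * Iσ) := by
    rw [ht2] at h4
    calc _ ≤ ENNReal.ofReal (G z) * volume (box e t) := by gcongr
      _ ≤ _ := h1.trans (h2.trans h3)
      _ = _ := by ring_nf
  have h6 : ENNReal.ofReal (δ ^ n) = ENNReal.ofReal (8 ^ (n + 1) / δ) * ENNReal.ofReal ((δ / 8) ^ (n + 1)) := by
    rw [← ENNReal.ofReal_mul (by positivity)]
    congr 1
    rw [div_pow]
    field_simp
    ring
  calc ENNReal.ofReal (δ ^ n) * ENNReal.ofReal (G z)
      = ENNReal.ofReal (8 ^ (n + 1) / δ) * Vb⁻¹ *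
        (ENNReal.ofReal (G z) * (ENNReal.ofReal ((δ / 8) ^ (n + 1)) * Vb)) := by
        rw [h6]
        calc _ = ENNReal.ofReal (8 ^ (n + 1) / δ) * ENNReal.ofReal ((δ / 8) ^ (n + 1)) * ENNReal.ofReal (G z) * (Vb⁻¹ * Vb) := by
              rw [ENNReal.inv_mul_cancel hV0 hVt, mul_one]
          _ = _ := by ring
    _ ≤ ENNReal.ofReal (8 ^ (n + 1) / δ) * Vb⁻¹ * (cS n * (ENNReal.ofReal (2 * δ) * Iσ)) := by gcongr
    _ = (ENNReal.ofReal (8 ^ (n + 1) / δ) * ENNReal.ofReal (2 * δ)) * cS n * Vb⁻¹ * Iσ := by ring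
    _ = _ := by
        rw [← ENNReal.ofReal_mul (by positivity)]
        congr 4
        field_simp


section abstractVS
variable {X : Type*} [MeasurableSpace X]

/-- adjoint kernel operator -/
def Tst (μ : Measure X) (κ : X → ℝ≥0∞) (p : X → X → ℝ≥0∞) (g : X → ℝ≥0∞) (y : X) : ℝ≥0∞ :=
  ∫⁻ z, κ z * p z y * g z ∂μ

lemma Tst_measurable (μ : Measure X) [SFinite μ] {κ : X → ℝ≥0∞} {p : X → X → ℝ≥0∞} {g : X → ℝ≥0∞}
    (hκ : Measurable κ) (hp : Measurable (Function.uncurry p)) (hg : Measurable g) :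
    Measurable (Tst μ κ p g) := by
  unfold Tst
  apply Measurable.lintegral_prod_left'
    (f := fun q : X × X => κ q.1 * p q.1 q.2 * g q.1)
  have : Measurable (fun q : X × X => p q.1 q.2) := hp
  fun_prop

lemma VS_key (μ ν : Measure X) [SFinite μ] [SFinite ν] {κ : X → ℝ≥0∞} {p : X → X → ℝ≥0∞}
    {g : X → ℝ≥0∞}
    (hκ : Measurable κ) (hp : Measurable (Function.uncurry p)) (hg : Measurable g)
    (hsymm : ∀ x y, p x y = p y x) (A : ℝ≥0∞)
    (hA : ∀ z x w, p z x * p x w ≤ A * (p z w * (p z x + p x w)))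
    (Cν : ℝ≥0∞) (hν : ∀ᵐ z ∂μ, κ z * ∫⁻ y, p z y ∂ν ≤ Cν) :
    ∫⁻ y, (Tst μ κ p g y) ^ 2 ∂ν ≤ 2 * A * Cν * ∫⁻ z, g z * Tst μ κ p g z ∂μ := by
  have hp1 : Measurable (fun q : X × X => p q.1 q.2) := hp
  have hpl : ∀ y, Measurable (fun z => p z y) := fun y => hp1.comp (measurable_id.prodMk measurable_const)
  have hpr : ∀ y, Measurable (fun z => p y z) := fun y => hp1.comp (measurable_const.prodMk measurable_id)
  -- step 1: expand the square
  have e1 : ∀ y, (Tst μ κ p g y) ^ 2 =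
      ∫⁻ z, ∫⁻ w, (κ z * p z y * g z) * (κ w * p w y * g w) ∂μ ∂μ := by
    intro y
    rw [sq]
    conv_lhs => enter [1]; rw [Tst]
    rw [← lintegral_mul_const]
    · apply lintegral_congr
      intro z
      rw [Tst, ← lintegral_const_mul]
      have := hpl y
      fun_prop
    · have := hpl y
      fun_prop
  have hm3 : Measurable (fun q : X × (X × X) => (κ q.2.1 * p q.2.1 q.1 * g q.2.1) *
      (κ q.2.2 * p q.2.2 q.1 * g q.2.2)) := by
    have h1 : Measurable (fun q : X × (X × X) => p q.2.1 q.1) :=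
      hp1.comp (measurable_snd.fst.prodMk measurable_fst)
    have h2 : Measurable (fun q : X × (X × X) => p q.2.2 q.1) :=
      hp1.comp (measurable_snd.snd.prodMk measurable_fst)
    fun_prop
  have e2 : ∫⁻ y, (Tst μ κ p g y) ^ 2 ∂ν =
      ∫⁻ z, ∫⁻ w, ∫⁻ y, (κ z * p z y * g z) * (κ w * p w y * g w) ∂ν ∂μ ∂μ := by
    simp_rw [e1]
    rw [lintegral_lintegral_swap]
    · apply lintegral_congr
      intro z
      rw [lintegral_lintegral_swap]
      exact (hm3.comp (measurable_fst.prodMk (measurable_const.prodMk measurable_snd))).aemeasurable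
    · apply Measurable.aemeasurable
      apply Measurable.lintegral_prod_right'
        (f := fun q : (X × X) × X => (κ q.1.2 * p q.1.2 q.1.1 * g q.1.2) * (κ q.2 * p q.2 q.1.1 * g q.2))
      exact hm3.comp (measurable_fst.fst.prodMk (measurable_fst.snd.prodMk measurable_snd))
  rw [e2]
  calc _ ≤ ∫⁻ z, ∫⁻ w, A * Cν * (g z * (κ w * p w z * g w)) + A * Cν * (g z * κ z * p z w * g w) ∂μ ∂μ := by
        apply lintegral_mono_ae
        filter_upwards [hν] with z hz
        apply lintegral_mono_ae
        filter_upwards [hν] with w hw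
        calc ∫⁻ y, (κ z * p z y * g z) * (κ w * p w y * g w) ∂ν
            ≤ ∫⁻ y, (κ z * g z * κ w * g w * A * p z w) * (p z y + p w y) ∂ν := by
              apply lintegral_mono
              intro y
              have := hA z y w
              rw [hsymm y w] at this
              calc (κ z * p z y * g z) * (κ w * p w y * g w)
                  = κ z * g z * κ w * g w * (p z y * p w y) := by ring
                _ ≤ κ z * g z * κ w * g w * (A * (p z w * (p z y + p w y))) := by gcongr
                _ = _ := by ring
          _ = (κ z * g z * κ w * g w * A * p z w) * (∫⁻ y, p z y ∂ν + ∫⁻ y, p w y ∂ν) := by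
              rw [lintegral_const_mul, lintegral_add_left (hpr z)]
              exact (hpr z).add (hpr w)
          _ = (g z * κ w * g w * A * p z w) * (κ z * ∫⁻ y, p z y ∂ν) +
              (κ z * g z * g w * A * p z w) * (κ w * ∫⁻ y, p w y ∂ν) := by ring
          _ ≤ (g z * κ w * g w * A * p z w) * Cν + (κ z * g z * g w * A * p z w) * Cν := by gcongr
          _ = _ := by rw [hsymm w z]; ring
    _ = ∫⁻ z, (A * Cν * (g z * Tst μ κ p g z)) +
          ∫⁻ w, A * Cν * (g z * κ z * p z w * g w) ∂μ ∂μ := by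
        apply lintegral_congr
        intro z
        rw [lintegral_add_left]
        · congr 1
          rw [Tst, lintegral_const_mul, lintegral_const_mul]
          · have := hpl z
            fun_prop
          · have := hpl z
            fun_prop
        · have := hpl z
          fun_prop
    _ = A * Cν * ∫⁻ z, g z * Tst μ κ p g z ∂μ +
          ∫⁻ z, ∫⁻ w, A * Cν * (g z * κ z * p z w * g w) ∂μ ∂μ := by
        have := Tst_measurable μ hκ hp hg
        rw [lintegral_add_left, lintegral_const_mul]
        · fun_prop
        · fun_prop
    _ = A * Cν * ∫⁻ z, g z * Tst μ κ p g z ∂μ + A * Cν * ∫⁻ z, g z * Tst μ κ p g z ∂μ := by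
        congr 1
        rw [lintegral_lintegral_swap, ← lintegral_const_mul]
        · apply lintegral_congr
          intro w
          rw [Tst, ← lintegral_const_mul, ← lintegral_const_mul]
          · apply lintegral_congr
            intro z
            ring
          · have := hpl w
            fun_prop
          · have := hpl w
            fun_prop
        · have := Tst_measurable μ hκ hp hg
          fun_prop
        · apply Measurable.aemeasurable
          have : Measurable (fun q : X × X => A * Cν * (g q.1 * κ q.1 * p q.1 q.2 * g q.2)) := by fun_prop
          exact this
    _ = _ := by ring

lemma lintegral_CS (μ : Measure X) {f g : X → ℝ≥0∞} (hf : AEMeasurable f μ) (hg : AEMeasurable g μ) :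
    (∫⁻ x, f x * g x ∂μ) ^ 2 ≤ (∫⁻ x, f x ^ 2 ∂μ) * ∫⁻ x, g x ^ 2 ∂μ := by
  have h := ENNReal.lintegral_mul_le_Lp_mul_Lq μ Real.HolderConjugate.two_two hf hg
  simp only [Pi.mul_apply] at h
  calc _ ≤ ((∫⁻ x, f x ^ (2:ℝ) ∂μ) ^ (1 / (2:ℝ)) * (∫⁻ x, g x ^ (2:ℝ) ∂μ) ^ (1 / (2:ℝ))) ^ 2 := by gcongr
    _ = _ := by
      rw [mul_pow, ← ENNReal.rpow_natCast, ← ENNReal.rpow_natCast, ← ENNReal.rpow_mul, ← ENNReal.rpow_mul]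
      norm_num

lemma le_of_sq_le {a b : ℝ≥0∞} (ha : a ≠ ∞) (h : a ^ 2 ≤ b * a) : a ≤ b := by
  by_cases h0 : a = 0
  · simp [h0]
  · rw [sq] at h
    exact (ENNReal.mul_le_mul_iff_left h0 ha).1 h

lemma VS_main (μ σ : Measure X) [SFinite μ] [SFinite σ] {κ : X → ℝ≥0∞} {p : X → X → ℝ≥0∞}
    {g : X → ℝ≥0∞}
    (hκ : Measurable κ) (hp : Measurable (Function.uncurry p)) (hg : Measurable g)
    (hsymm : ∀ x y, p x y = p y x) (A : ℝ≥0∞)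
    (hA : ∀ z x w, p z x * p x w ≤ A * (p z w * (p z x + p x w)))
    (C1 C2 : ℝ≥0∞) (h1 : ∀ᵐ z ∂μ, κ z * ∫⁻ y, p z y ∂σ ≤ C1)
    (h2 : ∀ᵐ z ∂μ, κ z * ∫⁻ y, p z y ∂μ ≤ C2)
    (hfin : ∫⁻ z, g z * Tst μ κ p g z ∂μ ≠ ∞) :
    ∫⁻ y, (Tst μ κ p g y) ^ 2 ∂σ ≤ 4 * A ^ 2 * C1 * C2 * ∫⁻ z, g z ^ 2 ∂μ := by
  have hT := Tst_measurable μ hκ hp hg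
  have e1 := VS_key μ σ hκ hp hg hsymm A hA C1 h1
  have e2 := VS_key μ μ hκ hp hg hsymm A hA C2 h2
  have e3 := lintegral_CS μ hg.aemeasurable hT.aemeasurable
  set Φ := ∫⁻ z, g z * Tst μ κ p g z ∂μ
  have e4 : Φ ≤ (∫⁻ z, g z ^ 2 ∂μ) * (2 * A * C2) := by
    apply le_of_sq_le hfin
    refine e3.trans ?_
    rw [mul_assoc]
    gcongr
  calc _ ≤ _ := e1
    _ ≤ 2 * A * C1 * ((∫⁻ z, g z ^ 2 ∂μ) * (2 * A * C2)) := by gcongr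
    _ = _ := by ring

/-- abstract embedding -/
lemma VS_embed (μ σ : Measure X) [SFinite μ] [SFinite σ] {κ : X → ℝ≥0∞} {p : X → X → ℝ≥0∞}
    {g u : X → ℝ≥0∞}
    (hκ : Measurable κ) (hp : Measurable (Function.uncurry p)) (hg : Measurable g) (hu : Measurable u)
    (hsymm : ∀ x y, p x y = p y x) (A : ℝ≥0∞)
    (hA : ∀ z x w, p z x * p x w ≤ A * (p z w * (p z x + p x w)))
    (C0 C1 C2 : ℝ≥0∞) (h1 : ∀ᵐ z ∂μ, κ z * ∫⁻ y, p z y ∂σ ≤ C1)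
    (h2 : ∀ᵐ z ∂μ, κ z * ∫⁻ y, p z y ∂μ ≤ C2)
    (hfin : ∫⁻ z, g z * Tst μ κ p g z ∂μ ≠ ∞) (hfin2 : ∫⁻ z, g z ^ 2 ∂μ ≠ ∞)
    (h0 : ∀ᵐ z ∂μ, g z ≤ C0 * (κ z * ∫⁻ y, p z y * u y ∂σ)) :
    ∫⁻ z, g z ^ 2 ∂μ ≤ C0 ^ 2 * (4 * A ^ 2 * C1 * C2) * ∫⁻ y, u y ^ 2 ∂σ := by
  have hp1 : Measurable (fun q : X × X => p q.1 q.2) := hp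
  have hpl : ∀ y, Measurable (fun z => p z y) := fun y => hp1.comp (measurable_id.prodMk measurable_const)
  have hpr : ∀ y, Measurable (fun z => p y z) := fun y => hp1.comp (measurable_const.prodMk measurable_id)
  have hT := Tst_measurable μ hκ hp hg
  have e1 := VS_main μ σ hκ hp hg hsymm A hA C1 C2 h1 h2 hfin
  have e2 := lintegral_CS σ hu.aemeasurable hT.aemeasurable
  have e3 : ∫⁻ z, g z ^ 2 ∂μ ≤ C0 * ∫⁻ y, u y * Tst μ κ p g y ∂σ := by
    calc ∫⁻ z, g z ^ 2 ∂μ ≤ ∫⁻ z, ∫⁻ y, C0 * (u y * (κ z * p z y * g z)) ∂σ ∂μ := by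
          apply lintegral_mono_ae
          filter_upwards [h0] with z hz
          calc g z ^ 2 = g z * g z := sq _
            _ ≤ (C0 * (κ z * ∫⁻ y, p z y * u y ∂σ)) * g z := by gcongr
            _ = (C0 * κ z * g z) * ∫⁻ y, p z y * u y ∂σ := by ring
            _ = ∫⁻ y, (C0 * κ z * g z) * (p z y * u y) ∂σ := by
              rw [lintegral_const_mul]
              exact (hpr z).mul hu
            _ = _ := by
              apply lintegral_congr
              intro y
              ring
      _ = ∫⁻ y, ∫⁻ z, C0 * (u y * (κ z * p z y * g z)) ∂μ ∂σ := by
          rw [lintegral_lintegral_swap]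
          apply Measurable.aemeasurable
          have : Measurable (fun q : X × X => C0 * (u q.2 * (κ q.1 * p q.1 q.2 * g q.1))) := by fun_prop
          exact this
      _ = _ := by
          rw [← lintegral_const_mul]
          · apply lintegral_congr
            intro y
            have := hpl y
            rw [Tst, ← lintegral_const_mul, ← lintegral_const_mul]
            all_goals fun_prop
          · fun_prop
  apply le_of_sq_le hfin2
  calc (∫⁻ z, g z ^ 2 ∂μ) ^ 2 ≤ (C0 * ∫⁻ y, u y * Tst μ κ p g y ∂σ) ^ 2 := by gcongr
    _ = C0 ^ 2 * (∫⁻ y, u y * Tst μ κ p g y ∂σ) ^ 2 := by ring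
    _ ≤ C0 ^ 2 * ((∫⁻ y, u y ^ 2 ∂σ) * (4 * A ^ 2 * C1 * C2 * ∫⁻ z, g z ^ 2 ∂μ)) := by
        gcongr
        exact e2.trans (by gcongr)
    _ = _ := by ring
end abstractVS


/-- the kernel exponent weight -/
def kap {n : ℕ} (z : En n) : ℝ≥0∞ := ENNReal.ofReal ((1 - ‖z‖) ^ (3 * n))

/-- the kernel -/
def pk {n : ℕ} (z y : En n) : ℝ≥0∞ :=
  (closedBall (0 : En n) 1 ×ˢ closedBall (0 : En n) 1).indicator
    (fun q : En n × En n => (ENNReal.ofReal (‖1 - herm q.2 q.1‖ ^ (4 * n)))⁻¹) (z, y)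

lemma pk_of_le {n : ℕ} {z y : En n} (hz : ‖z‖ ≤ 1) (hy : ‖y‖ ≤ 1) :
    pk z y = (ENNReal.ofReal (‖1 - herm y z‖ ^ (4 * n)))⁻¹ := by
  unfold pk
  rw [Set.indicator_of_mem]
  simp [hz, hy]

lemma pk_zero_left {n : ℕ} {z y : En n} (hz : ¬ ‖z‖ ≤ 1) : pk z y = 0 := by
  unfold pk
  rw [Set.indicator_of_notMem]
  simp [hz]

lemma pk_zero_right {n : ℕ} {z y : En n} (hz : ¬ ‖y‖ ≤ 1) : pk z y = 0 := by
  unfold pk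
  rw [Set.indicator_of_notMem]
  simp [hz]

lemma pk_symm {n : ℕ} (z y : En n) : pk z y = pk y z := by
  by_cases hz : ‖z‖ ≤ 1
  · by_cases hy : ‖y‖ ≤ 1
    · rw [pk_of_le hz hy, pk_of_le hy hz, herm_comm]
    · rw [pk_zero_right hy, pk_zero_left hy]
  · rw [pk_zero_left hz, pk_zero_right hz]

lemma kap_measurable (n : ℕ) : Measurable (kap : En n → ℝ≥0∞) := by
  unfold kap; fun_prop

lemma pk_measurable (n : ℕ) : Measurable (fun q : En n × En n => pk q.1 q.2) := by
  unfold pk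
  apply Measurable.indicator
  · have : Continuous (fun q : En n × En n => herm q.2 q.1) := by
      simp_rw [herm_eq]; fun_prop
    exact (ENNReal.measurable_ofReal.comp ((continuous_const.sub this).norm.pow _).measurable).inv
  · exact (isClosed_closedBall.measurableSet).prod isClosed_closedBall.measurableSet

lemma sub_sq_le {n : ℕ} {z x : En n} (hz : ‖z‖ ≤ 1) (hx : ‖x‖ ≤ 1) :
    ‖z - x‖ ^ 2 ≤ 2 * ‖1 - herm z x‖ := by
  rw [@norm_sub_sq ℂ, herm_eq]
  have h1 : RCLike.re (1 - inner ℂ x z) ≤ ‖1 - inner ℂ x z‖ := RCLike.re_le_norm _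
  rw [map_sub, RCLike.one_re, inner_re_symm] at h1
  nlinarith [norm_nonneg z, norm_nonneg x]

lemma one_sub_le_d {n : ℕ} {z x : En n} (hz : ‖z‖ ≤ 1) :
    1 - ‖x‖ ≤ ‖1 - herm z x‖ := by
  have h1 : ‖(1:ℂ)‖ - ‖herm z x‖ ≤ ‖1 - herm z x‖ := norm_sub_norm_le _ _
  have h2 := herm_le z x
  rw [norm_one] at h1
  nlinarith [norm_nonneg z, norm_nonneg x]

lemma d_quasi {n : ℕ} {z x w : En n} (hz : ‖z‖ ≤ 1) (hx : ‖x‖ ≤ 1) (hw : ‖w‖ ≤ 1) :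
    ‖1 - herm z w‖ ≤ 8 * max ‖1 - herm z x‖ ‖1 - herm x w‖ := by
  have e : 1 - herm z w = (1 - herm z x) + herm (z - x) (x - w) + (-(1 - herm x x) + (1 - herm x w)) := by
    simp only [herm_eq, inner_sub_left, inner_sub_right]; ring
  have h1 := sub_sq_le hz hx
  have h2 := sub_sq_le hx hw
  have h3 : ‖herm (z - x) (x - w)‖ ≤ ‖1 - herm z x‖ + ‖1 - herm x w‖ := by
    refine (herm_le _ _).trans ?_
    nlinarith [sq_nonneg (‖z - x‖ - ‖x - w‖)]
  have h4 : ‖1 - herm x x‖ ≤ 2 * ‖1 - herm x w‖ := by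
    rw [herm_comm x w]
    have h5 := one_sub_le_d (x := x) hw
    have h6 : (1 - herm x x) = ((1 - ‖x‖ ^ 2 : ℝ) : ℂ) := by
      rw [herm_eq, inner_self_eq_norm_sq_to_K]; simp
    rw [h6, Complex.norm_real, Real.norm_eq_abs, abs_of_nonneg (by nlinarith [norm_nonneg x])]
    nlinarith [norm_nonneg x]
  have h7 : ‖1 - herm z w‖ ≤ ‖1 - herm z x‖ + ‖herm (z - x) (x - w)‖ + (‖1 - herm x x‖ + ‖1 - herm x w‖) := by
    rw [e]
    refine (norm_add_le _ _).trans (add_le_add (norm_add_le _ _) ?_)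
    refine (norm_add_le _ _).trans ?_
    rw [norm_neg]
  have h8 := le_max_left ‖1 - herm z x‖ ‖1 - herm x w‖
  have h9 := le_max_right ‖1 - herm z x‖ ‖1 - herm x w‖
  have h10 := norm_nonneg (1 - herm x w)
  linarith

lemma inv_aux (a b A : ℝ) (m : ℕ) (hA : 0 < A) (h : a ≤ A * b) (ha : 0 ≤ a) :
    (ENNReal.ofReal (b ^ m))⁻¹ ≤ ENNReal.ofReal (A ^ m) * (ENNReal.ofReal (a ^ m))⁻¹ := by
  have h1 : ENNReal.ofReal (a ^ m) ≤ ENNReal.ofReal (A ^ m) * ENNReal.ofReal (b ^ m) := by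
    rw [← ENNReal.ofReal_mul (by positivity), ← mul_pow]
    exact ENNReal.ofReal_le_ofReal (pow_le_pow_left₀ ha h m)
  have hA0 : ENNReal.ofReal (A ^ m) ≠ 0 := by
    rw [Ne, ENNReal.ofReal_eq_zero, not_le]; positivity
  have h2 := ENNReal.inv_le_inv.2 h1
  rw [ENNReal.mul_inv (Or.inl hA0) (Or.inl ENNReal.ofReal_ne_top)] at h2
  calc (ENNReal.ofReal (b ^ m))⁻¹ = ENNReal.ofReal (A ^ m) * ((ENNReal.ofReal (A ^ m))⁻¹ * (ENNReal.ofReal (b ^ m))⁻¹) := by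
        rw [← mul_assoc, ENNReal.mul_inv_cancel hA0 ENNReal.ofReal_ne_top, one_mul]
    _ ≤ _ := by gcongr

lemma pk_quasi {n : ℕ} (z x w : En n) :
    pk z x * pk x w ≤ ENNReal.ofReal (8 ^ (4 * n)) * (pk z w * (pk z x + pk x w)) := by
  by_cases hz : ‖z‖ ≤ 1
  swap; · simp [pk_zero_left hz]
  by_cases hx : ‖x‖ ≤ 1
  swap; · simp [pk_zero_left hx]
  by_cases hw : ‖w‖ ≤ 1
  swap; · simp [pk_zero_right hw]
  have key : pk z x ≤ ENNReal.ofReal (8 ^ (4 * n)) * pk z w ∨ pk x w ≤ ENNReal.ofReal (8 ^ (4 * n)) * pk z w := by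
    rw [pk_of_le hz hx, pk_of_le hx hw, pk_of_le hz hw]
    have := d_quasi hz hx hw
    rw [herm_comm x z, herm_comm w z, herm_comm w x]
    rcases le_total ‖1 - herm z x‖ ‖1 - herm x w‖ with h | h
    · right; rw [max_eq_right h] at this
      exact inv_aux _ _ _ _ (by norm_num) this (norm_nonneg _)
    · left; rw [max_eq_left h] at this
      exact inv_aux _ _ _ _ (by norm_num) this (norm_nonneg _)
  rcases key with h | h
  · calc pk z x * pk x w ≤ (ENNReal.ofReal (8 ^ (4 * n)) * pk z w) * (pk z x + pk x w) := by
          gcongr; exact le_add_self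
      _ = _ := by ring
  · calc pk z x * pk x w = pk x w * pk z x := mul_comm _ _
      _ ≤ (ENNReal.ofReal (8 ^ (4 * n)) * pk z w) * (pk z x + pk x w) := by
          gcongr; exact le_self_add
      _ = _ := by ring

/-- reproducing-type domination -/
lemma kernel_dom {n : ℕ} (hn : 1 ≤ n) : ∃ C : ℝ≥0∞, C ≠ ∞ ∧ ∀ (F : En n → l2) (R : ℝ), 1 < R →
    DifferentiableOn ℂ F (ball 0 R) → ∀ z : En n, ‖z‖ < 1 →
    ENNReal.ofReal √‖F z‖ ≤ C * (kap z * ∫⁻ ζ, pk z ζ * ENNReal.ofReal √‖F (retr ζ)‖ ∂(sig n)) := by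
  obtain ⟨C, hC, hp⟩ := point_eval hn
  refine ⟨ENNReal.ofReal (2 ^ (4 * n)) * C, ENNReal.mul_ne_top ENNReal.ofReal_ne_top hC, ?_⟩
  intro F R hR hF z hz
  -- radius
  obtain ⟨R', hR'1, hR'R, hR'z⟩ : ∃ R', 1 < R' ∧ R' ≤ R ∧ R' * ‖z‖ < 1 := by
    by_cases h0 : ‖z‖ = 0
    · exact ⟨R, hR, le_rfl, by rw [h0]; simp⟩
    · have hz0 : 0 < ‖z‖ := lt_of_le_of_ne (norm_nonneg _) (Ne.symm h0)
      obtain ⟨a, ha1, ha2⟩ := exists_between ((one_lt_inv₀ hz0).2 hz)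
      refine ⟨min a R, lt_min ha1 hR, min_le_right _ _, ?_⟩
      have : min a R ≤ a := min_le_left _ _
      have h2 : a * ‖z‖ < 1 := by
        rw [← inv_mul_cancel₀ h0]; gcongr
      nlinarith
  have hne : ∀ w : En n, ‖w‖ < R' → 1 - herm w z ≠ 0 := by
    intro w hw h
    have h1 := herm_le w z
    have h2 : herm w z = 1 := (sub_eq_zero.1 h).symm
    rw [h2, norm_one] at h1
    nlinarith [norm_nonneg z]
  set Fz : En n → l2 := fun w => ((1 - herm w z)⁻¹) ^ (8 * n) • F w with hFz
  have hd : DifferentiableOn ℂ Fz (ball 0 R') := by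
    apply DifferentiableOn.fun_smul
    · apply DifferentiableOn.fun_pow
      apply DifferentiableOn.fun_inv
      · apply Differentiable.differentiableOn
        simp_rw [herm_eq]
        exact (differentiable_const _).sub (innerSL ℂ z).differentiable
      · intro w hw; exact hne w (mem_ball_zero_iff.1 hw)
    · exact hF.mono (ball_subset_ball hR'R)
  have hsq : ∀ w : En n, √‖Fz w‖ = (‖1 - herm w z‖ ^ (4 * n))⁻¹ * √‖F w‖ := by
    intro w
    rw [hFz]; dsimp only
    rw [norm_smul, norm_pow, norm_inv, Real.sqrt_mul (by positivity), inv_pow]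
    congr 1
    rw [show 8 * n = (4 * n) * 2 by ring, pow_mul, Real.sqrt_inv, Real.sqrt_sq (by positivity)]
  have key := hp _ (subM_of_diff hR'1 hd) z hz
  rw [retr_eq hz.le, hsq] at key
  have hzz : ‖1 - herm z z‖ = 1 - ‖z‖ ^ 2 := by
    have h6 : (1 - herm z z) = ((1 - ‖z‖ ^ 2 : ℝ) : ℂ) := by
      rw [herm_eq, inner_self_eq_norm_sq_to_K]; simp
    rw [h6, Complex.norm_real, Real.norm_eq_abs, abs_of_nonneg (by nlinarith [norm_nonneg z])]
  rw [hzz] at key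
  have hδ : 0 < 1 - ‖z‖ := by linarith
  have hIntEq : ∫⁻ ζ, ENNReal.ofReal √‖Fz (retr ζ)‖ ∂(sig n) =
      ∫⁻ ζ, pk z ζ * ENNReal.ofReal √‖F (retr ζ)‖ ∂(sig n) := by
    apply lintegral_congr_ae
    filter_upwards [ae_sig_norm n] with ζ hζ
    rw [pk_of_le hz.le hζ.le, retr_eq hζ.le, hsq, ENNReal.ofReal_mul (by positivity),
      ENNReal.ofReal_inv_of_pos]
    have := hne ζ (by rw [hζ]; exact hR'1)
    have := norm_pos_iff.2 this
    positivity
  rw [hIntEq] at key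
  have hle : √‖F z‖ ≤ 2 ^ (4 * n) * (1 - ‖z‖) ^ (3 * n) * ((1 - ‖z‖) ^ n * (((1 - ‖z‖ ^ 2) ^ (4 * n))⁻¹ * √‖F z‖)) := by
    have h1 : (1 - ‖z‖ ^ 2) ^ (4 * n) ≤ (2 * (1 - ‖z‖)) ^ (4 * n) := by
      apply pow_le_pow_left₀ <;> nlinarith [norm_nonneg z]
    have h2 : 0 < (1 - ‖z‖ ^ 2) ^ (4 * n) := by
      apply pow_pos; nlinarith [norm_nonneg z]
    have h3 : 2 ^ (4 * n) * (1 - ‖z‖) ^ (3 * n) * ((1 - ‖z‖) ^ n * (((1 - ‖z‖ ^ 2) ^ (4 * n))⁻¹ * √‖F z‖))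
      = ((2 * (1 - ‖z‖)) ^ (4 * n) * ((1 - ‖z‖ ^ 2) ^ (4 * n))⁻¹) * √‖F z‖ := by
      rw [mul_pow, show 4 * n = 3 * n + n by ring, pow_add (1 - ‖z‖)]; ring
    rw [h3]
    apply le_mul_of_one_le_left (Real.sqrt_nonneg _)
    rw [← div_eq_mul_inv, one_le_div h2]; exact h1
  calc ENNReal.ofReal √‖F z‖ ≤ ENNReal.ofReal (2 ^ (4 * n)) * kap z * (ENNReal.ofReal ((1 - ‖z‖) ^ n) * ENNReal.ofReal (((1 - ‖z‖ ^ 2) ^ (4 * n))⁻¹ * √‖F z‖)) := by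
        unfold kap
        rw [← ENNReal.ofReal_mul (by positivity), ← ENNReal.ofReal_mul (by positivity),
          ← ENNReal.ofReal_mul (by positivity)]
        exact ENNReal.ofReal_le_ofReal hle
    _ ≤ ENNReal.ofReal (2 ^ (4 * n)) * kap z * (C * ∫⁻ ζ, pk z ζ * ENNReal.ofReal √‖F (retr ζ)‖ ∂(sig n)) := by
        gcongr
    _ = _ := by ring


/-- quasi-ball -/
def qb {n : ℕ} (z : En n) (s : ℝ) : Set (En n) := {y | ‖y‖ ≤ 1 ∧ ‖1 - herm y z‖ < s}

lemma qb_meas {n : ℕ} (z : En n) (s : ℝ) : MeasurableSet (qb z s) := by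
  apply MeasurableSet.inter
  · exact (isClosed_le continuous_norm continuous_const).measurableSet
  · exact (isOpen_lt (continuous_const.sub (measurable_herm_left z)).norm continuous_const).measurableSet

lemma dyadic {n : ℕ} (hn : 1 ≤ n) (ν : Measure (En n)) (z : En n) (hz : ‖z‖ < 1) (M : ℝ≥0∞)
    (h : ∀ s : ℝ, 1 - ‖z‖ ≤ s → ν (qb z s) ≤ M * ENNReal.ofReal (s ^ n)) :
    kap z * ∫⁻ y, pk z y ∂ν ≤ ENNReal.ofReal (2 ^ n * 2) * M := by
  set δ := 1 - ‖z‖ with hδ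
  have hδ0 : 0 < δ := by linarith
  have hpt : ∀ y, pk z y ≤ ∑' k : ℕ, (qb z (2 ^ (k + 1) * δ)).indicator
      (fun _ => ENNReal.ofReal (((2 ^ k * δ) ^ (4 * n))⁻¹)) y := by
    intro y
    by_cases hy : ‖y‖ ≤ 1
    swap; · rw [pk_zero_right hy]; exact zero_le
    have hd : δ ≤ ‖1 - herm y z‖ := one_sub_le_d hy
    obtain ⟨k, hk1, hk2⟩ := exists_nat_pow_near (x := ‖1 - herm y z‖ / δ) (y := 2)
      ((one_le_div hδ0).2 hd) one_lt_two
    rw [le_div_iff₀ hδ0] at hk1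
    rw [div_lt_iff₀ hδ0] at hk2
    refine le_trans ?_ (ENNReal.le_tsum k)
    rw [Set.indicator_of_mem (show y ∈ qb z _ from ⟨hy, hk2⟩), pk_of_le hz.le hy,
      ENNReal.ofReal_inv_of_pos (by positivity)]
    apply ENNReal.inv_le_inv.2
    apply ENNReal.ofReal_le_ofReal
    gcongr
  calc kap z * ∫⁻ y, pk z y ∂ν
      ≤ kap z * ∫⁻ y, (∑' k : ℕ, (qb z (2 ^ (k + 1) * δ)).indicator
      (fun _ => ENNReal.ofReal (((2 ^ k * δ) ^ (4 * n))⁻¹)) y) ∂ν := by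
        gcongr with y; exact hpt y
    _ = kap z * ∑' k : ℕ, ENNReal.ofReal (((2 ^ k * δ) ^ (4 * n))⁻¹) * ν (qb z (2 ^ (k + 1) * δ)) := by
        rw [lintegral_tsum]
        · congr 2; ext k
          rw [lintegral_indicator_const (qb_meas _ _)]
        · intro k
          exact (measurable_const.indicator (qb_meas _ _)).aemeasurable
    _ = ∑' k : ℕ, kap z * (ENNReal.ofReal (((2 ^ k * δ) ^ (4 * n))⁻¹) * ν (qb z (2 ^ (k + 1) * δ))) := by
        rw [ENNReal.tsum_mul_left]
    _ ≤ ∑' k : ℕ, ENNReal.ofReal (2 ^ n * (1 / 2) ^ k) * M := by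
        apply ENNReal.tsum_le_tsum
        intro k
        have h1 := h (2 ^ (k + 1) * δ) (le_mul_of_one_le_left hδ0.le (one_le_pow₀ one_le_two))
        calc kap z * (ENNReal.ofReal (((2 ^ k * δ) ^ (4 * n))⁻¹) * ν (qb z (2 ^ (k + 1) * δ)))
            ≤ kap z * (ENNReal.ofReal (((2 ^ k * δ) ^ (4 * n))⁻¹) * (M * ENNReal.ofReal ((2 ^ (k + 1) * δ) ^ n))) := by
              gcongr
          _ = ENNReal.ofReal (δ ^ (3 * n) * (((2 ^ k * δ) ^ (4 * n))⁻¹ * (2 ^ (k + 1) * δ) ^ n)) * M := by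
              rw [ENNReal.ofReal_mul (by positivity), ENNReal.ofReal_mul (by positivity), kap]; ring
          _ ≤ _ := by
              refine mul_le_mul_left ?_ M
              apply ENNReal.ofReal_le_ofReal
              have e1 : δ ^ (3 * n) * (((2 ^ k * δ) ^ (4 * n))⁻¹ * (2 ^ (k + 1) * δ) ^ n)
                = 2 ^ n * ((2 ^ k) ^ (3 * n))⁻¹ := by
                rw [show 4 * n = 3 * n + n by ring, pow_add (2 ^ k * δ), mul_pow _ δ (3 * n), pow_succ 2 k,
                  show 2 ^ k * 2 * δ = 2 * (2 ^ k * δ) by ring, mul_pow 2]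
                have : (2 ^ k * δ) ^ n ≠ 0 := by positivity
                field_simp
              rw [e1, one_div, inv_pow]
              have : (2:ℝ) ^ k ≤ (2 ^ k) ^ (3 * n) := le_self_pow₀ (one_le_pow₀ one_le_two) (by omega)
              gcongr
    _ = _ := by
        rw [ENNReal.tsum_mul_right, ← ENNReal.ofReal_tsum_of_nonneg]
        · rw [tsum_mul_left, tsum_geometric_two]
        · intro k; positivity
        · exact summable_geometric_two.mul_left _

lemma vol_qb {n : ℕ} (hn : 1 ≤ n) (z : En n) (hz : ‖z‖ < 1) (s : ℝ) (hs : 1 - ‖z‖ ≤ s) :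
    volume (qb z s) ≤ ENNReal.ofReal ((4 * s) ^ (n + 1)) * volume (ball (0 : En n) 2) := by
  obtain ⟨e, he, hze⟩ := exists_unit hn z
  have hs0 : 0 < s := by linarith
  have hsub : qb z s ⊆ (fun w => w - e) ⁻¹' (box e (2 * √s)) := by
    rintro w ⟨hw1, hw2⟩
    have hd : ‖1 - herm w e‖ < 2 * s := by
      have e1 : 1 - herm w e = (1 - herm w z) - ((1 - ‖z‖ : ℝ) : ℂ) * herm w e := by
        have : herm w z = (‖z‖ : ℂ) * herm w e := by
          conv_lhs => rw [hze]
          rw [herm_eq, inner_smul_left, ← herm_eq]; simp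
        rw [this]; push_cast; ring
      rw [e1]
      refine (norm_sub_le _ _).trans_lt ?_
      rw [norm_mul, Complex.norm_real, Real.norm_eq_abs, abs_of_pos (by linarith)]
      have := herm_le w e
      rw [he, mul_one] at this
      nlinarith [norm_nonneg (herm w e)]
    have hsq : (2 * √s) ^ 2 = 4 * s := by rw [mul_pow, Real.sq_sqrt hs0.le]; norm_num
    constructor
    · have : herm (w - e) e = -(1 - herm w e) := by
        rw [herm_eq, herm_eq, inner_sub_right, inner_self_eq_norm_sq_to_K, he]; simp
      rw [this, norm_neg, hsq]; linarith
    · apply lt_of_pow_lt_pow_left₀ 2 (by positivity)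
      rw [hsq]
      have := sub_sq_le hw1 he.le
      change ‖w - e‖ ^ 2 < _
      linarith
  calc volume (qb z s) ≤ volume ((fun w => w - e) ⁻¹' (box e (2 * √s))) := measure_mono hsub
    _ = volume (box e (2 * √s)) := by
        simp_rw [sub_eq_add_neg]
        exact measure_preimage_add_right _ _ _
    _ ≤ _ := by
        have := box_upper e he (2 * √s) (by positivity)
        rwa [show (2 * √s) ^ 2 = 4 * s by rw [mul_pow, Real.sq_sqrt hs0.le]; norm_num] at this

lemma sig_qb {n : ℕ} (hn : 1 ≤ n) : ∃ C : ℝ≥0∞, C ≠ ∞ ∧ ∀ z : En n, ‖z‖ < 1 → ∀ s : ℝ, 1 - ‖z‖ ≤ s →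
    sig n (qb z s) ≤ C * ENNReal.ofReal (s ^ n) := by
  have := sig_prob hn
  set V2 := volume (ball (0 : En n) 2)
  have hV2 : V2 ≠ ∞ := measure_ball_lt_top.ne
  refine ⟨ENNReal.ofReal (2 ^ n) + (cS n)⁻¹ * (ENNReal.ofReal (8 ^ (n + 1) * 2 ^ (2 * n - 1)) * V2), ?_, ?_⟩
  · refine ENNReal.add_ne_top.2 ⟨ENNReal.ofReal_ne_top, ?_⟩
    exact ENNReal.mul_ne_top (ENNReal.inv_ne_top.2 (cS_ne_zero hn)) (ENNReal.mul_ne_top ENNReal.ofReal_ne_top hV2)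
  intro z hz s hs
  have hs0 : 0 < s := by linarith
  by_cases hs2 : 1 / 2 ≤ s
  · calc sig n (qb z s) ≤ 1 := prob_le_one
      _ ≤ ENNReal.ofReal (2 ^ n) * ENNReal.ofReal (s ^ n) := by
          rw [← ENNReal.ofReal_mul (by positivity), ← mul_pow, ← ENNReal.ofReal_one]
          apply ENNReal.ofReal_le_ofReal
          exact one_le_pow₀ (by linarith)
      _ ≤ _ := by gcongr; exact le_self_add
  push Not at hs2
  have hpol := polar hn (h := (qb z (2 * s)).indicator (fun _ => (1 : ℝ≥0∞)))
    (measurable_const.indicator (qb_meas _ _))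
  rw [lintegral_indicator_const (qb_meas _ _), one_mul] at hpol
  have hlow : sig n (qb z s) * ENNReal.ofReal (s * (1 / 2) ^ (2 * n - 1)) ≤
      ∫⁻ ζ, (∫⁻ r in Ioi (0:ℝ), (qb z (2 * s)).indicator (fun _ => (1 : ℝ≥0∞)) (r • ζ) * ENNReal.ofReal (r ^ (2 * n - 1))) ∂(sig n) := by
    rw [mul_comm, ← lintegral_indicator_const (qb_meas z s)]
    apply lintegral_mono
    intro ζ
    beta_reduce
    by_cases hζ : ζ ∈ qb z s
    swap; · rw [Set.indicator_of_notMem hζ]; exact zero_le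
    rw [Set.indicator_of_mem hζ]
    calc ENNReal.ofReal (s * (1 / 2) ^ (2 * n - 1)) = ∫⁻ r in Ioo (1 - s) 1, ENNReal.ofReal ((1 / 2) ^ (2 * n - 1)) := by
          rw [lintegral_const, Measure.restrict_apply MeasurableSet.univ, univ_inter, Real.volume_Ioo,
            ← ENNReal.ofReal_mul (by positivity)]
          congr 1; ring
      _ ≤ ∫⁻ r in Ioo (1 - s) 1, (qb z (2 * s)).indicator (fun _ => (1 : ℝ≥0∞)) (r • ζ) * ENNReal.ofReal (r ^ (2 * n - 1)) := by
          apply setLIntegral_mono' measurableSet_Ioo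
          intro r hr
          have hmem : r • ζ ∈ qb z (2 * s) := by
            obtain ⟨h1, h2⟩ := hζ
            have hr0 : 0 < r := by linarith [hr.1]
            constructor
            · rw [norm_smul, Real.norm_eq_abs, abs_of_pos hr0]
              nlinarith [norm_nonneg ζ, hr.2]
            · have e1 : herm (r • ζ) z = (r : ℂ) * herm ζ z := herm_smul_left (r : ℂ) ζ z
              have e2 : 1 - herm (r • ζ) z = (1 - herm ζ z) + ((1 - r : ℝ) : ℂ) * herm ζ z := by
                rw [e1]; push_cast; ring
              rw [e2]
              refine (norm_add_le _ _).trans_lt ?_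
              rw [norm_mul, Complex.norm_real, Real.norm_eq_abs, abs_of_pos (by linarith [hr.2])]
              have h3 := herm_le ζ z
              have h4 : ‖herm ζ z‖ ≤ 1 := h3.trans (by nlinarith [norm_nonneg ζ, norm_nonneg z])
              nlinarith [hr.1, hr.2]
          rw [Set.indicator_of_mem hmem, one_mul]
          apply ENNReal.ofReal_le_ofReal
          apply pow_le_pow_left₀ (by norm_num)
          linarith [hr.1]
      _ ≤ _ := lintegral_mono_set (fun r hr => by simp only [mem_Ioi]; linarith [hr.1])
  have hup := vol_qb hn z hz (2 * s) (by linarith)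
  rw [hpol] at hup
  have h1 : cS n * (sig n (qb z s) * ENNReal.ofReal (s * (1 / 2) ^ (2 * n - 1))) ≤
      ENNReal.ofReal ((4 * (2 * s)) ^ (n + 1)) * V2 := le_trans (by gcongr) hup
  set q := ENNReal.ofReal (s * (1 / 2) ^ (2 * n - 1)) with hq
  have hq0 : q ≠ 0 := by
    rw [hq, Ne, ENNReal.ofReal_eq_zero, not_le]; positivity
  have hqt : q ≠ ∞ := ENNReal.ofReal_ne_top
  calc sig n (qb z s) = (cS n)⁻¹ * (cS n * (sig n (qb z s) * q)) * q⁻¹ := by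
        rw [← mul_assoc (cS n)⁻¹, ENNReal.inv_mul_cancel (cS_ne_zero hn) (cS_ne_top n), one_mul, mul_assoc,
          ENNReal.mul_inv_cancel hq0 hqt, mul_one]
    _ ≤ (cS n)⁻¹ * (ENNReal.ofReal ((4 * (2 * s)) ^ (n + 1)) * V2) * q⁻¹ := by gcongr
    _ = (cS n)⁻¹ * (ENNReal.ofReal (8 ^ (n + 1) * 2 ^ (2 * n - 1)) * V2) * ENNReal.ofReal (s ^ n) := by
        have : ENNReal.ofReal ((4 * (2 * s)) ^ (n + 1)) * q⁻¹ = ENNReal.ofReal (8 ^ (n + 1) * 2 ^ (2 * n - 1)) * ENNReal.ofReal (s ^ n) := by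
          rw [hq, ← ENNReal.ofReal_inv_of_pos (by positivity), ← ENNReal.ofReal_mul (by positivity),
            ← ENNReal.ofReal_mul (by positivity)]
          congr 1
          rw [show 4 * (2 * s) = 8 * s by ring, mul_pow, one_div, inv_pow, pow_succ s]
          field_simp
        calc _ = (cS n)⁻¹ * V2 * (ENNReal.ofReal ((4 * (2 * s)) ^ (n + 1)) * q⁻¹) := by ring
          _ = _ := by rw [this]; ring
    _ ≤ _ := by gcongr; exact le_add_self

lemma kap_sig {n : ℕ} (hn : 1 ≤ n) : ∃ C : ℝ≥0∞, C ≠ ∞ ∧ ∀ z : En n, ‖z‖ < 1 →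
    kap z * ∫⁻ y, pk z y ∂(sig n) ≤ C := by
  obtain ⟨C, hC, h⟩ := sig_qb hn
  exact ⟨_, ENNReal.mul_ne_top ENNReal.ofReal_ne_top hC, fun z hz => dyadic hn _ z hz C (h z hz)⟩


lemma l2_norm_sq (v : l2) : HasSum (fun i => ‖v i‖ ^ 2) (‖v‖ ^ 2) := by
  have h := lp.hasSum_norm (p := 2) (by norm_num) v
  simpa using h

lemma hsSq_eq {n : ℕ} (g : En n → l2) (z : En n) :
    hsSq g z = ∑ j, ‖fderiv ℂ g z (EuclideanSpace.single j 1)‖ ^ 2 := by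
  unfold hsSq
  exact (hasSum_sum fun j _ => l2_norm_sq _).tsum_eq

lemma hsSq_nonneg {n : ℕ} (g : En n → l2) (z : En n) : 0 ≤ hsSq g z := by
  rw [hsSq_eq]; positivity

lemma hsSq_measurable {n : ℕ} (g : En n → l2) : Measurable (hsSq g) := by
  have : hsSq g = fun z => ∑ j, ‖fderiv ℂ g z (EuclideanSpace.single j 1)‖ ^ 2 := by
    ext z; exact hsSq_eq g z
  rw [this]
  borelize l2
  apply Finset.measurable_sum
  intro j _
  exact ((measurable_fderiv_apply_const ℂ g _).norm).pow_const 2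

lemma fderiv_le {n : ℕ} (g : En n → l2) (z w : En n) :
    ‖fderiv ℂ g z w‖ ^ 2 ≤ ‖w‖ ^ 2 * hsSq g z := by
  have hw : w = ∑ j, w j • EuclideanSpace.single j (1:ℂ) := by
    ext i; simp [Pi.single_apply]
  have e : fderiv ℂ g z w = ∑ j, w j • fderiv ℂ g z (EuclideanSpace.single j 1) := by
    conv_lhs => rw [hw]
    simp
  rw [e, hsSq_eq, EuclideanSpace.norm_sq_eq]
  calc ‖∑ j, w j • fderiv ℂ g z (EuclideanSpace.single j 1)‖ ^ 2
      ≤ (∑ j, ‖w j‖ * ‖fderiv ℂ g z (EuclideanSpace.single j 1)‖) ^ 2 := by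
        gcongr
        refine (norm_sum_le _ _).trans (le_of_eq ?_)
        simp_rw [norm_smul]
    _ ≤ _ := Finset.sum_mul_sq_le_sq_mul_sq _ _ _

lemma radD_eq {n : ℕ} (g : En n → l2) (z : En n) : radD g z = fderiv ℂ g z z := by
  have hw : z = ∑ j, z j • EuclideanSpace.single j (1:ℂ) := by
    ext i; simp [Pi.single_apply]
  unfold radD
  conv_rhs => rw [hw]
  rw [map_sum]
  simp_rw [map_smul]
  rw [← hw]

lemma radD_le {n : ℕ} (g : En n → l2) (z : En n) : ‖radD g z‖ ^ 2 ≤ ‖z‖ ^ 2 * hsSq g z := by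
  rw [radD_eq]; exact fderiv_le g z z

/-- the Carleson measure -/
def muM {n : ℕ} (g : En n → l2) : Measure (En n) :=
  ((volume : Measure (En n)).restrict (ball (0 : En n) 1)).withDensity
    fun z => ENNReal.ofReal (hsSq g z * (1 - ‖z‖ ^ 2))

/-- the Carleson constant -/
def cmG {n : ℕ} (g : En n → l2) : ℝ≥0∞ :=
  cmSq (fun z => (1 - ‖z‖ ^ 2) ^ ((n : ℝ) / 2 + 1) * Real.sqrt (hsSq g z))

lemma dens_meas {n : ℕ} (g : En n → l2) : Measurable (fun z : En n => ENNReal.ofReal (hsSq g z * (1 - ‖z‖ ^ 2))) := by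
  have := hsSq_measurable g
  fun_prop

instance {n : ℕ} (g : En n → l2) : SFinite (muM g) := by
  unfold muM; infer_instance

lemma muM_ae {n : ℕ} (g : En n → l2) : ∀ᵐ z ∂(muM g), ‖z‖ < 1 := by
  have h : muM g ≪ (volume : Measure (En n)).restrict (ball (0 : En n) 1) := withDensity_absolutelyContinuous _ _
  apply h.ae_le
  filter_upwards [ae_restrict_mem measurableSet_ball] with z hz
  exact mem_ball_zero_iff.1 hz

lemma tent_meas {n : ℕ} (ζ : En n) : MeasurableSet (tent ζ) := by
  apply MeasurableSet.inter measurableSet_ball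
  have : Measurable (fun z : En n => (1 - ‖ζ‖) / ‖1 - herm z ζ‖) :=
    measurable_const.div ((continuous_const.sub (measurable_herm_left ζ)).norm.measurable)
  exact measurableSet_lt measurable_const this

lemma tent_int {n : ℕ} (g : En n → l2) (ζ : En n) :
    ∫⁻ z in tent ζ, ENNReal.ofReal (((1 - ‖z‖ ^ 2) ^ ((n : ℝ) / 2 + 1) * Real.sqrt (hsSq g z)) ^ 2) ∂(lambdaM n)
      = muM g (tent ζ) := by
  have hh := hsSq_measurable g
  have m1 : Measurable (fun z : En n => ENNReal.ofReal ((1 - ‖z‖ ^ 2) ^ (-(n : ℝ) - 1))) := by fun_prop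
  have m2 : Measurable (fun z : En n => ENNReal.ofReal (((1 - ‖z‖ ^ 2) ^ ((n : ℝ) / 2 + 1) * Real.sqrt (hsSq g z)) ^ 2)) := by
    have : Measurable (fun z : En n => √(hsSq g z)) := hh.sqrt
    fun_prop
  rw [lambdaM, muM, setLIntegral_withDensity_eq_setLIntegral_mul _ m1 m2 (tent_meas ζ), withDensity_apply _ (tent_meas ζ)]
  apply setLIntegral_congr_fun (tent_meas ζ)
  intro z hz
  have hz1 : ‖z‖ < 1 := mem_ball_zero_iff.1 hz.1
  have hp : 0 < 1 - ‖z‖ ^ 2 := by nlinarith [norm_nonneg z]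
  simp only [Pi.mul_apply]
  rw [← ENNReal.ofReal_mul (by positivity)]
  congr 1
  rw [mul_pow, Real.sq_sqrt (hsSq_nonneg g z), ← Real.rpow_natCast ((1 - ‖z‖ ^ 2) ^ ((n : ℝ) / 2 + 1)) 2, ← Real.rpow_mul hp.le, ← mul_assoc,
    ← Real.rpow_add hp]
  have : -(n:ℝ) - 1 + ((n:ℝ) / 2 + 1) * ((2:ℕ) : ℝ) = 1 := by push_cast; ring
  rw [this, Real.rpow_one]; ring

lemma tent_le {n : ℕ} (g : En n → l2) (ζ : En n) (h0 : ζ ≠ 0) (h1 : ‖ζ‖ < 1) :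
    muM g (tent ζ) ≤ cmG g * ENNReal.ofReal ((1 - ‖ζ‖) ^ n) := by
  have h2 : (ENNReal.ofReal ((1 - ‖ζ‖) ^ n))⁻¹ * muM g (tent ζ) ≤ cmG g := by
    rw [← tent_int]
    unfold cmG cmSq
    exact le_iSup₂_of_le ζ ⟨mem_ball_zero_iff.2 h1, h0⟩ le_rfl
  have hp : ENNReal.ofReal ((1 - ‖ζ‖) ^ n) ≠ 0 := by
    rw [Ne, ENNReal.ofReal_eq_zero, not_le]
    apply pow_pos; linarith
  calc muM g (tent ζ) = ((ENNReal.ofReal ((1 - ‖ζ‖) ^ n))⁻¹ * muM g (tent ζ)) * ENNReal.ofReal ((1 - ‖ζ‖) ^ n) := by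
        rw [mul_comm, ← mul_assoc, ENNReal.mul_inv_cancel hp ENNReal.ofReal_ne_top, one_mul]
    _ ≤ _ := by gcongr

lemma mem_tent {n : ℕ} {ζ y : En n} (hy : ‖y‖ < 1) (h1 : ‖ζ‖ < 1) (h : ‖1 - herm y ζ‖ < 2 * (1 - ‖ζ‖)) :
    y ∈ tent ζ := by
  refine ⟨mem_ball_zero_iff.2 hy, ?_⟩
  have := one_sub_le_d (x := ζ) hy.le
  rw [lt_div_iff₀ (by linarith)]
  linarith

lemma muM_univ {n : ℕ} (hn : 1 ≤ n) (g : En n → l2) : muM g univ ≤ cmG g := by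
  obtain ⟨e, he, -⟩ := exists_unit hn 0
  have hn4 : ‖((1/4:ℝ) : ℂ) • e‖ = 1/4 := by rw [norm_smul, he, Complex.norm_real]; norm_num
  have h1 := tent_le g (((1/4:ℝ) : ℂ) • e) (by rw [← norm_pos_iff, hn4]; norm_num) (by rw [hn4]; norm_num)
  calc muM g univ ≤ muM g (tent (((1/4:ℝ) : ℂ) • e)) := by
        apply measure_mono_ae
        filter_upwards [muM_ae g] with y hy _
        apply mem_tent hy (by rw [hn4]; norm_num)
        rw [hn4]
        refine (norm_sub_le _ _).trans_lt ?_
        have := herm_le y (((1/4:ℝ) : ℂ) • e)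
        rw [hn4] at this
        rw [norm_one]; linarith
    _ ≤ _ := h1
    _ ≤ cmG g * 1 := by
        gcongr
        rw [hn4, ENNReal.ofReal_le_one]
        exact pow_le_one₀ (by norm_num) (by norm_num)
    _ = _ := mul_one _

lemma muM_qb {n : ℕ} (hn : 1 ≤ n) (g : En n → l2) (z : En n) (hz : ‖z‖ < 1) (s : ℝ) (hs : 1 - ‖z‖ ≤ s) :
    muM g (qb z s) ≤ (ENNReal.ofReal (2 ^ n) * cmG g) * ENNReal.ofReal (s ^ n) := by
  have hs0 : 0 < s := by linarith
  by_cases hs2 : 1 / 2 ≤ s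
  · calc muM g (qb z s) ≤ cmG g * 1 := by
          rw [mul_one]; exact (measure_mono (subset_univ _)).trans (muM_univ hn g)
      _ ≤ cmG g * (ENNReal.ofReal (2 ^ n) * ENNReal.ofReal (s ^ n)) := by
          gcongr
          rw [← ENNReal.ofReal_mul (by positivity), ← mul_pow, ← ENNReal.ofReal_one]
          apply ENNReal.ofReal_le_ofReal
          exact one_le_pow₀ (by linarith)
      _ = _ := by ring
  push Not at hs2
  obtain ⟨e, he, hze⟩ := exists_unit hn z
  have hn4 : ‖((1 - s : ℝ) : ℂ) • e‖ = 1 - s := by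
    rw [norm_smul, he, Complex.norm_real, Real.norm_eq_abs, abs_of_pos (by linarith), mul_one]
  have h1 := tent_le g (((1 - s:ℝ) : ℂ) • e) (by rw [← norm_pos_iff, hn4]; linarith) (by rw [hn4]; linarith)
  rw [hn4, show 1 - (1 - s) = s by ring] at h1
  calc muM g (qb z s) ≤ muM g (tent (((1 - s:ℝ) : ℂ) • e)) := by
        apply measure_mono_ae
        filter_upwards [muM_ae g] with y hy hq
        obtain ⟨-, hq⟩ := hq
        apply mem_tent hy (by rw [hn4]; linarith)
        rw [hn4]
        have e1 : ∀ t : ℝ, herm y ((t : ℂ) • e) = (t : ℂ) * herm y e := by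
          intro t
          rw [herm_eq, inner_smul_left, ← herm_eq]; simp
        have e2 : herm y z = (‖z‖ : ℂ) * herm y e := by
          conv_lhs => rw [hze]
          exact e1 _
        have e3 : 1 - herm y (((1 - s:ℝ) : ℂ) • e) = (1 - herm y z) + ((‖z‖ - (1 - s) : ℝ) : ℂ) * herm y e := by
          rw [e1, e2]; push_cast; ring
        rw [e3]
        refine (norm_add_le _ _).trans_lt ?_
        rw [norm_mul, Complex.norm_real, Real.norm_eq_abs, abs_of_nonneg (by linarith)]
        have := herm_le y e
        rw [he, mul_one] at this
        nlinarith [norm_nonneg (herm y e)]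
    _ ≤ _ := h1
    _ ≤ (1 * cmG g) * ENNReal.ofReal (s ^ n) := by rw [one_mul]
    _ ≤ _ := by
        gcongr
        rw [← ENNReal.ofReal_one]
        exact ENNReal.ofReal_le_ofReal (one_le_pow₀ one_le_two)

lemma kap_mu {n : ℕ} (hn : 1 ≤ n) (g : En n → l2) (z : En n) (hz : ‖z‖ < 1) :
    kap z * ∫⁻ y, pk z y ∂(muM g) ≤ ENNReal.ofReal (2 ^ n * 2) * (ENNReal.ofReal (2 ^ n) * cmG g) :=
  dyadic hn _ z hz _ (muM_qb hn g z hz)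


lemma dil_diff {n : ℕ} {f : En n → l2} (hf : DifferentiableOn ℂ f (ball 0 1)) {r : ℝ} (h0 : 0 < r) :
    DifferentiableOn ℂ (fun z => f (r • z)) (ball 0 r⁻¹) := by
  have h : DifferentiableOn ℂ (fun z : En n => (r : ℂ) • z) (ball 0 r⁻¹) := by fun_prop
  refine (hf.comp h ?_)
  intro z hz
  rw [mem_ball_zero_iff] at hz ⊢
  rw [norm_smul, Real.norm_eq_abs, abs_of_pos h0]
  calc r * ‖z‖ < r * r⁻¹ := by gcongr
    _ = 1 := mul_inv_cancel₀ h0.ne'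

lemma dil_cont {n : ℕ} {f : En n → l2} (hf : DifferentiableOn ℂ f (ball 0 1)) {r : ℝ} (h0 : 0 < r) (h1 : r < 1) :
    Continuous (fun z : En n => f (r • retr z)) := by
  have h2 := (dil_diff hf h0).continuousOn
  rw [← continuousOn_univ]
  apply h2.comp (retr_cont n).continuousOn
  intro z _
  rw [mem_ball_zero_iff]
  exact (retr_norm z).trans_lt ((one_lt_inv₀ h0).2 h1)

lemma sphere_le_h1 {n : ℕ} (f : En n → l2) {r : ℝ} (h0 : 0 < r) (h1 : r < 1) :
    ∫⁻ ζ, ENNReal.ofReal ‖f (r • ζ)‖ ∂(sig n) ≤ h1Ball f := by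
  rw [lintegral_sig]
  exact le_iSup₂_of_le r ⟨h0, h1⟩ le_rfl

lemma embed_r {n : ℕ} (hn : 1 ≤ n) : ∃ C : ℝ≥0∞, C ≠ ∞ ∧ ∀ (f g : En n → l2),
    DifferentiableOn ℂ f (ball 0 1) → cmG g ≠ ∞ → ∀ r : ℝ, 0 < r → r < 1 →
    ∫⁻ z in closedBall 0 r, ENNReal.ofReal ‖f (r • retr z)‖ ∂(muM g) ≤ C * cmG g * h1Ball f := by
  obtain ⟨C0, hC0, hk⟩ := kernel_dom hn
  obtain ⟨C1, hC1, hs⟩ := kap_sig hn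
  set A := ENNReal.ofReal (8 ^ (4 * n)) with hA
  set c2 := ENNReal.ofReal (2 ^ n * 2) * ENNReal.ofReal (2 ^ n) with hc2
  refine ⟨C0 ^ 2 * (4 * A ^ 2 * C1 * c2), ?_, ?_⟩
  · have : A ≠ ∞ := ENNReal.ofReal_ne_top
    have : c2 ≠ ∞ := ENNReal.mul_ne_top ENNReal.ofReal_ne_top ENNReal.ofReal_ne_top
    finiteness
  intro f g hf hM r h0 h1
  set μ := (muM g).restrict (closedBall (0 : En n) r) with hμ
  set G : En n → ℝ≥0∞ := fun z => ENNReal.ofReal √‖f (r • retr z)‖ with hG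
  have hGm : Measurable G := by
    have := (dil_cont hf h0 h1).norm.sqrt.measurable
    exact this.ennreal_ofReal
  obtain ⟨B, hB⟩ : ∃ B : ℝ, ∀ z, G z ≤ ENNReal.ofReal B := by
    have hc := (dil_cont hf h0 h1).norm.sqrt
    obtain ⟨B, hB⟩ := (isCompact_closedBall (0 : En n) 1).exists_bound_of_continuousOn hc.continuousOn
    refine ⟨B, fun z => ENNReal.ofReal_le_ofReal ?_⟩
    have h3 := hB (retr z) (by rw [mem_closedBall_zero_iff]; exact retr_norm z)
    rw [retr_eq (retr_norm z)] at h3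
    exact (le_abs_self _).trans h3
  have hμfin : μ univ ≠ ∞ := by
    refine ne_top_of_le_ne_top hM ?_
    exact (Measure.restrict_le_self _).trans (muM_univ hn g)
  have hμr : ∀ᵐ z ∂μ, ‖z‖ ≤ r := by
    filter_upwards [ae_restrict_mem isClosed_closedBall.measurableSet] with z hz
    exact mem_closedBall_zero_iff.1 hz
  have hG2 : ∀ z, ‖z‖ ≤ 1 → G z ^ 2 = ENNReal.ofReal ‖f (r • z)‖ := by
    intro z hz
    rw [hG]; dsimp only
    rw [retr_eq hz, ← ENNReal.ofReal_pow (Real.sqrt_nonneg _), Real.sq_sqrt (norm_nonneg _)]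
  have hG2' : ∀ z, G z ^ 2 = ENNReal.ofReal ‖f (r • retr z)‖ := by
    intro z
    rw [hG]; dsimp only
    rw [← ENNReal.ofReal_pow (Real.sqrt_nonneg _), Real.sq_sqrt (norm_nonneg _)]
  set K : ℝ≥0∞ := (ENNReal.ofReal ((1 - r) ^ (4 * n)))⁻¹ with hK
  have hKt : K ≠ ∞ := by
    rw [hK, Ne, ENNReal.inv_eq_top, ENNReal.ofReal_eq_zero, not_le]
    apply pow_pos; linarith
  have hT : ∀ y, Tst μ kap pk G y ≤ K * ENNReal.ofReal B * μ univ := by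
    intro y
    rw [← lintegral_const]
    apply lintegral_mono_ae
    filter_upwards [hμr] with z hz
    have hz1 : ‖z‖ ≤ 1 := by linarith
    have k1 : kap z ≤ 1 := by
      unfold kap
      rw [ENNReal.ofReal_le_one]
      exact pow_le_one₀ (by linarith) (by linarith [norm_nonneg z])
    have k2 : pk z y ≤ K := by
      by_cases hy : ‖y‖ ≤ 1
      swap; · rw [pk_zero_right hy]; exact zero_le
      rw [pk_of_le hz1 hy, hK]
      apply ENNReal.inv_le_inv.2
      apply ENNReal.ofReal_le_ofReal
      have := one_sub_le_d (x := z) hy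
      apply pow_le_pow_left₀ <;> linarith
    calc kap z * pk z y * G z ≤ 1 * K * ENNReal.ofReal B := by gcongr; exact hB z
      _ = _ := by rw [one_mul]
  have main := VS_embed μ (sig n) (κ := kap) (p := pk) (g := G) (u := G) (kap_measurable n) (pk_measurable n)
    hGm hGm pk_symm A pk_quasi C0 C1 (c2 * cmG g) ?_ ?_ ?_ ?_ ?_
  · calc ∫⁻ z in closedBall 0 r, ENNReal.ofReal ‖f (r • retr z)‖ ∂(muM g) = ∫⁻ z, G z ^ 2 ∂μ := by
          simp_rw [hG2']; rfl
      _ ≤ _ := main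
      _ ≤ C0 ^ 2 * (4 * A ^ 2 * C1 * (c2 * cmG g)) * h1Ball f := by
          gcongr
          refine le_trans (le_of_eq ?_) (sphere_le_h1 f h0 h1)
          apply lintegral_congr_ae
          filter_upwards [ae_sig_norm n] with ζ hζ
          exact hG2 ζ hζ.le
      _ = _ := by ring
  · filter_upwards [hμr] with z hz
    exact hs z (by linarith)
  · filter_upwards [hμr] with z hz
    refine le_trans ?_ ((kap_mu hn g z (by linarith)).trans (le_of_eq (by rw [hc2, mul_assoc])))
    gcongr
    exact Measure.restrict_le_self
  · refine ne_top_of_le_ne_top (b := ENNReal.ofReal B * (K * ENNReal.ofReal B * μ univ) * μ univ) (by finiteness) ?_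
    rw [← lintegral_const]
    apply lintegral_mono
    intro z
    exact mul_le_mul' (hB z) (hT z)
  · refine ne_top_of_le_ne_top (b := ENNReal.ofReal B ^ 2 * μ univ) (by finiteness) ?_
    rw [← lintegral_const]
    apply lintegral_mono
    intro z
    exact pow_le_pow_left' (hB z) 2
  · filter_upwards [hμr] with z hz
    have := hk (fun z => f (r • z)) r⁻¹ ((one_lt_inv₀ h0).2 h1) (dil_diff hf h0) z (by linarith)
    rw [hG]; dsimp only
    rw [retr_eq (by linarith)]
    exact this

lemma embed {n : ℕ} (hn : 1 ≤ n) : ∃ C : ℝ≥0∞, C ≠ ∞ ∧ ∀ (f g : En n → l2),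
    DifferentiableOn ℂ f (ball 0 1) → cmG g ≠ ∞ →
    ∫⁻ z, ENNReal.ofReal ‖f z‖ ∂(muM g) ≤ C * cmG g * h1Ball f := by
  obtain ⟨C, hC, h⟩ := embed_r hn
  refine ⟨C, hC, fun f g hf hM => ?_⟩
  set r : ℕ → ℝ := fun k => 1 - 1 / ((k : ℝ) + 2) with hr
  have hr0 : ∀ k, 0 < r k := by
    intro k; rw [hr]; dsimp only
    rw [sub_pos, div_lt_one (by positivity)]; linarith [(Nat.cast_nonneg k : (0:ℝ) ≤ k)]
  have hr1 : ∀ k, r k < 1 := by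
    intro k; rw [hr]; dsimp only
    rw [sub_lt_self_iff]; positivity
  have hrt : Filter.Tendsto r Filter.atTop (𝓝 1) := by
    have : Filter.Tendsto (fun k : ℕ => 1 / ((k : ℝ) + 2)) Filter.atTop (𝓝 0) := by
      simp_rw [one_div]
      apply Filter.Tendsto.inv_tendsto_atTop
      exact Filter.tendsto_atTop_add_const_right _ _ tendsto_natCast_atTop_atTop
    have h5 := (tendsto_const_nhds (x := (1:ℝ))).sub this
    rwa [sub_zero] at h5
  set Fk : ℕ → En n → ℝ≥0∞ := fun k => (closedBall (0 : En n) (r k)).indicator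
    (fun z => ENNReal.ofReal ‖f (r k • retr z)‖) with hFk
  have hFm : ∀ k, Measurable (Fk k) := fun k =>
    ((dil_cont hf (hr0 k) (hr1 k)).norm.measurable.ennreal_ofReal).indicator isClosed_closedBall.measurableSet
  have hle : ∀ k, ∫⁻ z, Fk k z ∂(muM g) ≤ C * cmG g * h1Ball f := by
    intro k
    rw [hFk]; dsimp only
    rw [lintegral_indicator isClosed_closedBall.measurableSet]
    exact h f g hf hM (r k) (hr0 k) (hr1 k)
  calc ∫⁻ z, ENNReal.ofReal ‖f z‖ ∂(muM g) ≤ ∫⁻ z, Filter.liminf (fun k => Fk k z) Filter.atTop ∂(muM g) := by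
        apply lintegral_mono_ae
        filter_upwards [muM_ae g] with z hz
        have : Filter.Tendsto (fun k => Fk k z) Filter.atTop (𝓝 (ENNReal.ofReal ‖f z‖)) := by
          have h3 : Filter.Tendsto (fun k => ENNReal.ofReal ‖f (r k • z)‖) Filter.atTop (𝓝 (ENNReal.ofReal ‖f z‖)) := by
            have hc : ContinuousAt f z := (hf.continuousOn.continuousAt (isOpen_ball.mem_nhds (mem_ball_zero_iff.2 hz)))
            have h4 : Filter.Tendsto (fun k => r k • z) Filter.atTop (𝓝 z) := by
              simpa using hrt.smul_const z
            exact ENNReal.tendsto_ofReal (hc.norm.tendsto.comp h4)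
          refine h3.congr' ?_
          filter_upwards [hrt.eventually (lt_mem_nhds hz)] with k hk
          rw [hFk]; dsimp only
          rw [Set.indicator_of_mem (by rw [mem_closedBall_zero_iff]; exact hk.le), retr_eq hz.le]
        rw [this.liminf_eq]
    _ ≤ Filter.liminf (fun k => ∫⁻ z, Fk k z ∂(muM g)) Filter.atTop := lintegral_liminf_le hFm
    _ ≤ _ := by
        refine Filter.liminf_le_of_le (by isBoundedDefault) ?_
        intro b hb
        obtain ⟨k, hk⟩ := hb.exists
        exact hk.trans (hle k)


lemma sq_le_prob {n : ℕ} (hn : 1 ≤ n) {u : En n → ℝ≥0∞} (hu : Measurable u) :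
    (∫⁻ ζ, u ζ ∂(sig n)) ^ 2 ≤ ∫⁻ ζ, u ζ ^ 2 ∂(sig n) := by
  have := sig_prob hn
  have h := lintegral_CS (sig n) hu.aemeasurable (aemeasurable_const (b := (1:ℝ≥0∞)))
  simpa using h

lemma f_sup {n : ℕ} (hn : 1 ≤ n) : ∃ C : ℝ≥0∞, C ≠ ∞ ∧ ∀ f : En n → l2,
    DifferentiableOn ℂ f (ball 0 1) → ∀ z : En n, ‖z‖ < 1 →
    ENNReal.ofReal (((1 - ‖z‖) / 2) ^ (2 * n)) * ENNReal.ofReal ‖f z‖ ≤ C * h1Ball f := by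
  obtain ⟨C, hC, h⟩ := point_eval hn
  refine ⟨C ^ 2, by finiteness, fun f hf z hz => ?_⟩
  set r := (1 + ‖z‖) / 2 with hr
  have hz0 := norm_nonneg z
  have h0 : 0 < r := by positivity
  have h1 : r < 1 := by rw [hr]; linarith
  have hw : ‖r⁻¹ • z‖ ≤ 1 - (1 - ‖z‖) / 2 := by
    rw [norm_smul, norm_inv, Real.norm_eq_abs, abs_of_pos h0, inv_mul_eq_div, div_le_iff₀ h0, hr]
    nlinarith
  have hw1 : ‖r⁻¹ • z‖ < 1 := by linarith
  have key := h _ (subM_of_diff ((one_lt_inv₀ h0).2 h1) (dil_diff hf h0)) (r⁻¹ • z) hw1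
  beta_reduce at key
  rw [retr_eq hw1.le, smul_smul, mul_inv_cancel₀ h0.ne', one_smul] at key
  have key2 : ENNReal.ofReal (((1 - ‖z‖) / 2) ^ n) * ENNReal.ofReal √‖f z‖ ≤
      C * ∫⁻ ζ, ENNReal.ofReal √‖f (r • retr ζ)‖ ∂(sig n) := by
    refine le_trans ?_ key
    gcongr
    linarith
  have key3 := pow_le_pow_left' key2 2
  calc ENNReal.ofReal (((1 - ‖z‖) / 2) ^ (2 * n)) * ENNReal.ofReal ‖f z‖
      = (ENNReal.ofReal (((1 - ‖z‖) / 2) ^ n) * ENNReal.ofReal √‖f z‖) ^ 2 := by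
        rw [mul_pow, ← ENNReal.ofReal_pow (by apply pow_nonneg; linarith), ← ENNReal.ofReal_pow (by positivity),
          Real.sq_sqrt (norm_nonneg _), ← pow_mul, mul_comm n 2]
    _ ≤ _ := key3
    _ ≤ C ^ 2 * ∫⁻ ζ, ENNReal.ofReal √‖f (r • retr ζ)‖ ^ 2 ∂(sig n) := by
        rw [mul_pow]
        gcongr
        exact sq_le_prob hn (dil_cont hf h0 h1).norm.sqrt.measurable.ennreal_ofReal
    _ ≤ C ^ 2 * h1Ball f := by
        gcongr
        refine le_trans (le_of_eq ?_) (sphere_le_h1 f h0 h1)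
        apply lintegral_congr_ae
        filter_upwards [ae_sig_norm n] with ζ hζ
        rw [retr_eq hζ.le, ← ENNReal.ofReal_pow (Real.sqrt_nonneg _), Real.sq_sqrt (norm_nonneg _)]

lemma slice_bound {n : ℕ} {g : En n → l2} (hg : DifferentiableOn ℂ g (ball 0 1)) {B : ℝ}
    (hB : ∀ w : En n, ‖w‖ ≤ 15 / 16 → ‖g w‖ ≤ B) (e : En n) (he : ‖e‖ = 1) (w : En n) (hw : ‖w‖ ≤ 3 / 4)
    (c : ℂ) (hc : ‖c‖ ≤ 1 / 16) : ‖g (w + c • e) - g w‖ ≤ (8 * B) * ‖c‖ := by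
  set φ : ℂ → l2 := fun l => g (w + l • e) with hφ
  have hlen : ∀ l : ℂ, ‖w + l • e‖ ≤ 3 / 4 + ‖l‖ := by
    intro l
    refine (norm_add_le _ _).trans ?_
    rw [norm_smul, he, mul_one]; linarith
  have hd : DifferentiableOn ℂ φ (ball 0 (1 / 4)) := by
    have : DifferentiableOn ℂ (fun l : ℂ => w + l • e) (ball 0 (1 / 4)) := by fun_prop
    refine hg.comp this ?_
    intro l hl
    rw [mem_ball_zero_iff] at *
    have := hlen l
    linarith
  have hder : ∀ l ∈ closedBall (0:ℂ) (1 / 16), ‖deriv φ l‖ ≤ 8 * B := by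
    intro l hl
    rw [mem_closedBall_zero_iff] at hl
    have h1 : ‖deriv φ l‖ ≤ B / (1 / 8) := by
      apply Complex.norm_deriv_le_of_forall_mem_sphere_norm_le (by norm_num)
      · apply DifferentiableOn.diffContOnCl
        rw [closure_ball _ (by norm_num)]
        apply hd.mono
        intro x hx
        rw [mem_closedBall, dist_eq_norm] at hx
        rw [mem_ball_zero_iff]
        calc ‖x‖ = ‖(x - l) + l‖ := by rw [sub_add_cancel]
          _ ≤ ‖x - l‖ + ‖l‖ := norm_add_le _ _
          _ < 1 / 4 := by linarith
      · intro x hx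
        rw [mem_sphere, dist_eq_norm] at hx
        apply hB
        have h2 : ‖x‖ ≤ ‖x - l‖ + ‖l‖ := by
          calc ‖x‖ = ‖(x - l) + l‖ := by rw [sub_add_cancel]
            _ ≤ ‖x - l‖ + ‖l‖ := norm_add_le _ _
        have := hlen x
        linarith
    linarith
  have := (convex_closedBall (0:ℂ) (1 / 16)).norm_image_sub_le_of_norm_deriv_le (f := φ) (x := 0) (y := c)
    (fun x hx => (hd.differentiableAt (isOpen_ball.mem_nhds (by
      rw [mem_ball_zero_iff]; rw [mem_closedBall_zero_iff] at hx; linarith)))) hder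
    (by simp) (by rw [mem_closedBall_zero_iff]; exact hc)
  simpa [hφ] using this

lemma deriv_eval {n : ℕ} (hn : 1 ≤ n) : ∃ C : ℝ≥0∞, C ≠ ∞ ∧ ∀ g : En n → l2,
    DifferentiableOn ℂ g (ball 0 1) → ∀ z : En n, ‖z‖ < 1 / 2 → ∀ e : En n, ‖e‖ = 1 → ∀ t : ℝ, 5 / 8 < t → t < 3 / 4 →
    ENNReal.ofReal ((1 / 5) ^ n) * ENNReal.ofReal √‖fderiv ℂ g z e‖ ≤
      C * ∫⁻ ζ, ENNReal.ofReal √‖fderiv ℂ g (t • ζ) e‖ ∂(sig n) := by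
  obtain ⟨C, hC, h⟩ := point_eval hn
  refine ⟨C, hC, fun g hg z hz e he t ht1 ht2 => ?_⟩
  have := sig_prob hn
  have ht0 : 0 < t := by linarith
  set c : ℕ → ℂ := fun k => ((16 * ((k : ℝ) + 1) : ℝ) : ℂ) with hc
  have hcn : ∀ k, ‖c k‖ = 16 * ((k : ℝ) + 1) := by
    intro k; rw [hc]; dsimp only
    rw [Complex.norm_real, Real.norm_eq_abs, abs_of_pos (by positivity)]
  have hci : ∀ k, ‖(c k)⁻¹‖ ≤ 1 / 16 := by
    intro k
    rw [norm_inv, hcn, one_div]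
    apply inv_anti₀ (by norm_num)
    linarith [(Nat.cast_nonneg k : (0:ℝ) ≤ k)]
  have hct : Filter.Tendsto (fun k => ‖c k‖) Filter.atTop Filter.atTop := by
    simp_rw [hcn]
    apply Filter.Tendsto.const_mul_atTop (by norm_num)
    exact Filter.tendsto_atTop_add_const_right _ _ tendsto_natCast_atTop_atTop
  have hck : ∀ k, c k ≠ 0 := by
    intro k; rw [← norm_pos_iff, hcn]; positivity
  obtain ⟨B, hB⟩ : ∃ B : ℝ, ∀ w : En n, ‖w‖ ≤ 15 / 16 → ‖g w‖ ≤ B := by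
    obtain ⟨B, hB⟩ := (isCompact_closedBall (0 : En n) (15 / 16)).exists_bound_of_continuousOn
      (hg.continuousOn.mono (closedBall_subset_ball (by norm_num)))
    exact ⟨B, fun w hw => hB w (mem_closedBall_zero_iff.2 hw)⟩
  set F : ℕ → En n → l2 := fun k w => c k • (g (t • w + (c k)⁻¹ • e) - g (t • w)) with hF
  have hnt : ∀ w : En n, ‖t • w‖ = t * ‖w‖ := by
    intro w; rw [norm_smul, Real.norm_eq_abs, abs_of_pos ht0]
  have hFd : ∀ k, DifferentiableOn ℂ (F k) (ball 0 (6 / 5)) := by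
    intro k
    have d1 : DifferentiableOn ℂ (fun w : En n => (t : ℂ) • w) (ball 0 (6 / 5)) := by fun_prop
    have d2 : DifferentiableOn ℂ (fun w : En n => (t : ℂ) • w + (c k)⁻¹ • e) (ball 0 (6 / 5)) := by fun_prop
    have d3 : DifferentiableOn ℂ (fun w : En n => g (t • w)) (ball 0 (6 / 5)) := by
      refine hg.comp d1 ?_
      intro w hw
      rw [mem_ball_zero_iff] at *
      change ‖t • w‖ < 1
      rw [hnt]; nlinarith [norm_nonneg w]
    have d4 : DifferentiableOn ℂ (fun w : En n => g (t • w + (c k)⁻¹ • e)) (ball 0 (6 / 5)) := by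
      refine hg.comp d2 ?_
      intro w hw
      rw [mem_ball_zero_iff] at *
      change ‖t • w + (c k)⁻¹ • e‖ < 1
      refine (norm_add_le _ _).trans_lt ?_
      rw [norm_smul (c k)⁻¹, he, hnt]
      have := hci k
      nlinarith [norm_nonneg w]
    exact (d4.sub d3).const_smul (c k)
  have hlim : ∀ w : En n, ‖w‖ ≤ 1 → Filter.Tendsto (fun k => F k w) Filter.atTop (𝓝 (fderiv ℂ g (t • w) e)) := by
    intro w hw
    have hm : t • w ∈ ball (0 : En n) 1 := by
      rw [mem_ball_zero_iff, hnt]; nlinarith [norm_nonneg w]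
    have hda := (hg.differentiableAt (isOpen_ball.mem_nhds hm)).hasFDerivAt
    exact hda.lim e hct
  have hlim2 : ∀ w : En n, ‖w‖ ≤ 1 → Filter.Tendsto (fun k => ENNReal.ofReal √‖F k (retr w)‖) Filter.atTop
      (𝓝 (ENNReal.ofReal √‖fderiv ℂ g (t • w) e‖)) := by
    intro w hw
    rw [retr_eq hw]
    exact ENNReal.tendsto_ofReal ((Real.continuous_sqrt.tendsto _).comp (hlim w hw).norm)
  have hbd : ∀ k, ∀ w : En n, ‖w‖ ≤ 1 → ENNReal.ofReal √‖F k (retr w)‖ ≤ ENNReal.ofReal √(8 * B) := by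
    intro k w hw
    rw [retr_eq hw]
    apply ENNReal.ofReal_le_ofReal
    apply Real.sqrt_le_sqrt
    rw [hF]; dsimp only
    rw [norm_smul]
    have h3 := slice_bound hg hB e he (t • w) (by rw [hnt]; nlinarith [norm_nonneg w]) (c k)⁻¹ (hci k)
    have h4 : 0 < ‖c k‖ := norm_pos_iff.2 (hck k)
    calc ‖c k‖ * _ ≤ ‖c k‖ * ((8 * B) * ‖(c k)⁻¹‖) := by gcongr
      _ = 8 * B := by rw [norm_inv]; field_simp
  have hw1 : ‖t⁻¹ • z‖ ≤ 4 / 5 := by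
    rw [norm_smul, norm_inv, Real.norm_eq_abs, abs_of_pos ht0, inv_mul_eq_div, div_le_iff₀ ht0]
    linarith
  have hk : ∀ k, ENNReal.ofReal ((1 / 5) ^ n) * ENNReal.ofReal √‖F k (retr (t⁻¹ • z))‖ ≤
      C * ∫⁻ ζ, ENNReal.ofReal √‖F k (retr ζ)‖ ∂(sig n) := by
    intro k
    refine le_trans ?_ (h _ (subM_of_diff (by norm_num) (hFd k)) (t⁻¹ • z) (by linarith))
    gcongr
    linarith
  have hI : Filter.Tendsto (fun k => ∫⁻ ζ, ENNReal.ofReal √‖F k (retr ζ)‖ ∂(sig n)) Filter.atTop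
      (𝓝 (∫⁻ ζ, ENNReal.ofReal √‖fderiv ℂ g (t • ζ) e‖ ∂(sig n))) := by
    apply tendsto_lintegral_of_dominated_convergence (fun _ => ENNReal.ofReal √(8 * B))
    · intro k
      exact (subM_of_diff (by norm_num) (hFd k)).cont.measurable.ennreal_ofReal
    · intro k
      filter_upwards [ae_sig_norm n] with ζ hζ
      exact hbd k ζ hζ.le
    · rw [lintegral_const]; finiteness
    · filter_upwards [ae_sig_norm n] with ζ hζ
      exact hlim2 ζ hζ.le
  have hL := hlim2 (t⁻¹ • z) (by linarith)
  rw [smul_smul, mul_inv_cancel₀ ht0.ne', one_smul] at hL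
  exact le_of_tendsto_of_tendsto' (ENNReal.Tendsto.const_mul hL (Or.inr ENNReal.ofReal_ne_top))
    (ENNReal.Tendsto.const_mul hI (Or.inr hC)) hk


lemma deriv_eval2 {n : ℕ} (hn : 1 ≤ n) : ∃ C : ℝ≥0∞, C ≠ ∞ ∧ ∀ g : En n → l2,
    DifferentiableOn ℂ g (ball 0 1) → ∀ z : En n, ‖z‖ < 1 / 2 → ∀ e : En n, ‖e‖ = 1 → ∀ t : ℝ, 5 / 8 < t → t < 3 / 4 →
    ENNReal.ofReal (‖fderiv ℂ g z e‖ ^ 2) ≤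
      C * ∫⁻ ζ, ENNReal.ofReal (hsSq g (t • ζ)) ∂(sig n) := by
  obtain ⟨C, hC, h⟩ := deriv_eval hn
  refine ⟨ENNReal.ofReal ((5 ^ n) ^ 4) * C ^ 4, by finiteness, fun g hg z hz e he t ht1 ht2 => ?_⟩
  have key := h g hg z hz e he t ht1 ht2
  set u : En n → ℝ≥0∞ := fun ζ => ENNReal.ofReal √‖fderiv ℂ g (t • ζ) e‖ with hu
  have hum : Measurable u := by
    borelize l2
    have h1 : Measurable (fun ζ : En n => t • ζ) := (continuous_const_smul t).measurable
    have h2 := (measurable_fderiv_apply_const ℂ g e).comp h1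
    exact (h2.norm.sqrt).ennreal_ofReal
  have h4 : ∀ a : ℝ, 0 ≤ a → ENNReal.ofReal √a ^ 4 = ENNReal.ofReal (a ^ 2) := by
    intro a ha
    rw [← ENNReal.ofReal_pow (Real.sqrt_nonneg _)]
    congr 1
    rw [show 4 = 2 * 2 by norm_num, pow_mul, Real.sq_sqrt ha]
  have hI : (∫⁻ ζ, u ζ ∂(sig n)) ^ 4 ≤ ∫⁻ ζ, ENNReal.ofReal (hsSq g (t • ζ)) ∂(sig n) := by
    calc (∫⁻ ζ, u ζ ∂(sig n)) ^ 4 = ((∫⁻ ζ, u ζ ∂(sig n)) ^ 2) ^ 2 := by rw [← pow_mul]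
      _ ≤ (∫⁻ ζ, u ζ ^ 2 ∂(sig n)) ^ 2 := pow_le_pow_left' (sq_le_prob hn hum) 2
      _ ≤ ∫⁻ ζ, (u ζ ^ 2) ^ 2 ∂(sig n) := sq_le_prob hn (hum.pow_const 2)
      _ ≤ _ := by
        apply lintegral_mono
        intro ζ
        beta_reduce
        rw [← pow_mul, hu]
        dsimp only
        rw [h4 _ (norm_nonneg _)]
        apply ENNReal.ofReal_le_ofReal
        have := fderiv_le g (t • ζ) e
        rwa [he, one_pow, one_mul] at this
  have key4 := pow_le_pow_left' key 4
  rw [mul_pow, mul_pow, h4 _ (norm_nonneg _), ← ENNReal.ofReal_pow (by positivity)] at key4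
  calc ENNReal.ofReal (‖fderiv ℂ g z e‖ ^ 2)
      = ENNReal.ofReal ((5 ^ n) ^ 4) * (ENNReal.ofReal (((1 / 5) ^ n) ^ 4) * ENNReal.ofReal (‖fderiv ℂ g z e‖ ^ 2)) := by
        rw [← mul_assoc, ← ENNReal.ofReal_mul (by positivity), ← mul_pow, ← mul_pow]; norm_num
    _ ≤ ENNReal.ofReal ((5 ^ n) ^ 4) * (C ^ 4 * ∫⁻ ζ, ENNReal.ofReal (hsSq g (t • ζ)) ∂(sig n)) := by
        refine mul_le_mul_right (key4.trans ?_) _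
        exact mul_le_mul_right hI _
    _ = _ := by ring

lemma deriv_sup {n : ℕ} (hn : 1 ≤ n) : ∃ C : ℝ≥0∞, C ≠ ∞ ∧ ∀ g : En n → l2,
    DifferentiableOn ℂ g (ball 0 1) → ∀ z : En n, ‖z‖ < 1 / 2 → ∀ e : En n, ‖e‖ = 1 →
    ENNReal.ofReal (‖fderiv ℂ g z e‖ ^ 2) ≤ C * cmG g := by
  obtain ⟨C, hC, h⟩ := deriv_eval2 hn
  set K : ℝ≥0∞ := ENNReal.ofReal (4 * 2 ^ (2 * n - 1)) with hK
  have hcS := cS_ne_zero hn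
  have hcS' : (cS n)⁻¹ ≠ ∞ := ENNReal.inv_ne_top.2 hcS
  refine ⟨8 * (C * K * (cS n)⁻¹), by finiteness, fun g hg z hz e he => ?_⟩
  set H : En n → ℝ≥0∞ := (ball (0 : En n) 1).indicator (fun z => ENNReal.ofReal (hsSq g z * (1 - ‖z‖ ^ 2))) with hH
  have hHm : Measurable H := (dens_meas g).indicator measurableSet_ball
  have hHint : ∫⁻ z, H z = muM g univ := by
    rw [hH, lintegral_indicator measurableSet_ball, muM, withDensity_apply _ MeasurableSet.univ,
      Measure.restrict_univ]
  have hpol := polar hn hHm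
  set J := ∫⁻ ζ, (∫⁻ r in Ioi (0:ℝ), H (r • ζ) * ENNReal.ofReal (r ^ (2 * n - 1))) ∂(sig n) with hJ
  have hJle : J ≤ (cS n)⁻¹ * cmG g := by
    calc J = (cS n)⁻¹ * (cS n * J) := by
          rw [← mul_assoc, ENNReal.inv_mul_cancel hcS (cS_ne_top n), one_mul]
      _ = (cS n)⁻¹ * muM g univ := by rw [← hpol, hHint]
      _ ≤ _ := by gcongr; exact muM_univ hn g
  have hswap : J = ∫⁻ r in Ioi (0:ℝ), (∫⁻ ζ, H (r • ζ) * ENNReal.ofReal (r ^ (2 * n - 1)) ∂(sig n)) := by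
    rw [hJ]
    apply lintegral_lintegral_swap
    apply Measurable.aemeasurable
    have m1 : Measurable (fun q : En n × ℝ => q.2 • q.1) := (continuous_snd.smul continuous_fst).measurable
    have m2 : Measurable (fun q : En n × ℝ => ENNReal.ofReal (q.2 ^ (2 * n - 1))) := by fun_prop
    exact (hHm.comp m1).mul m2
  set X := ENNReal.ofReal (‖fderiv ℂ g z e‖ ^ 2) with hX
  have hXt : ∀ t ∈ Ioo (5/8 : ℝ) (3/4), X ≤ C * K * ∫⁻ ζ, H (t • ζ) * ENNReal.ofReal (t ^ (2 * n - 1)) ∂(sig n) := by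
    intro t ht
    have ht0 : 0 < t := by linarith [ht.1]
    refine (h g hg z hz e he t ht.1 ht.2).trans ?_
    rw [mul_assoc]
    gcongr
    rw [← lintegral_const_mul' _ _ ENNReal.ofReal_ne_top]
    apply lintegral_mono_ae
    filter_upwards [ae_sig_norm n] with ζ hζ
    have hnt : ‖t • ζ‖ = t := by rw [norm_smul, hζ, Real.norm_eq_abs, abs_of_pos ht0, mul_one]
    rw [hH, Set.indicator_of_mem (by rw [mem_ball_zero_iff, hnt]; linarith [ht.2]), hnt,
      ← ENNReal.ofReal_mul (mul_nonneg (hsSq_nonneg _ _) (by nlinarith [ht.2])), ← ENNReal.ofReal_mul (by positivity)]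
    apply ENNReal.ofReal_le_ofReal
    have p1 : (1:ℝ) ≤ 2 ^ (2 * n - 1) * t ^ (2 * n - 1) := by
      rw [← mul_pow]; exact one_le_pow₀ (by linarith [ht.1])
    have p2 : (1:ℝ) ≤ 4 * (1 - t ^ 2) := by nlinarith [ht.2]
    have p3 := hsSq_nonneg g (t • ζ)
    calc hsSq g (t • ζ) = hsSq g (t • ζ) * (1 * 1) := by ring
      _ ≤ hsSq g (t • ζ) * ((4 * (1 - t ^ 2)) * (2 ^ (2 * n - 1) * t ^ (2 * n - 1))) := by
          gcongr
      _ = _ := by ring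
  have hXI : X * ENNReal.ofReal (1 / 8) ≤ C * K * J := by
    calc X * ENNReal.ofReal (1 / 8) = ∫⁻ t in Ioo (5/8 : ℝ) (3/4), X := by
          rw [lintegral_const, Measure.restrict_apply MeasurableSet.univ, univ_inter, Real.volume_Ioo]; norm_num
      _ ≤ ∫⁻ t in Ioo (5/8 : ℝ) (3/4), C * K * ∫⁻ ζ, H (t • ζ) * ENNReal.ofReal (t ^ (2 * n - 1)) ∂(sig n) :=
          setLIntegral_mono' measurableSet_Ioo hXt
      _ = C * K * ∫⁻ t in Ioo (5/8 : ℝ) (3/4), (∫⁻ ζ, H (t • ζ) * ENNReal.ofReal (t ^ (2 * n - 1)) ∂(sig n)) := by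
          rw [lintegral_const_mul' _ _ (by finiteness)]
      _ ≤ C * K * J := by
          rw [hswap]
          gcongr
          intro t ht
          simp only [mem_Ioi]; linarith [ht.1]
  calc X = 8 * (X * ENNReal.ofReal (1 / 8)) := by
        rw [show (8 : ℝ≥0∞) = ENNReal.ofReal 8 by norm_num, mul_comm, mul_assoc, ← ENNReal.ofReal_mul (by norm_num)]
        norm_num
    _ ≤ 8 * (C * K * ((cS n)⁻¹ * cmG g)) := by
        refine mul_le_mul_right (hXI.trans ?_) _
        exact mul_le_mul_right hJle _
    _ = _ := by ring

lemma radD_sup {n : ℕ} (hn : 1 ≤ n) : ∃ C : ℝ≥0∞, C ≠ ∞ ∧ ∀ g : En n → l2,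
    DifferentiableOn ℂ g (ball 0 1) → ∀ z : En n, ‖z‖ < 1 / 2 →
    ENNReal.ofReal (‖radD g z‖ ^ 2) ≤ C * cmG g * ENNReal.ofReal (‖z‖ ^ 2) := by
  obtain ⟨C, hC, h⟩ := deriv_sup hn
  refine ⟨C, hC, fun g hg z hz => ?_⟩
  obtain ⟨e, he, hze⟩ := exists_unit hn z
  have e1 : ‖radD g z‖ ^ 2 = ‖fderiv ℂ g z e‖ ^ 2 * ‖z‖ ^ 2 := by
    rw [radD_eq]
    have : fderiv ℂ g z z = (‖z‖ : ℂ) • fderiv ℂ g z e := by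
      rw [← map_smul, ← hze]
    rw [this, norm_smul, Complex.norm_real, norm_norm]; ring
  rw [e1, ENNReal.ofReal_mul (by positivity)]
  gcongr
  exact h g hg z hz e he

/-- the radial weight -/
def wt {n : ℕ} (z : En n) : ℝ := ‖z‖ ^ (-2 * (n : ℝ)) * Real.log (1 / ‖z‖)

lemma wt_meas (n : ℕ) : Measurable (wt : En n → ℝ) := by
  unfold wt; fun_prop

lemma wt_nonneg {n : ℕ} (z : En n) (hz : ‖z‖ < 1) : 0 ≤ wt z := by
  unfold wt
  by_cases h0 : ‖z‖ = 0
  · rw [h0]; simp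
  · have hp : 0 < ‖z‖ := lt_of_le_of_ne (norm_nonneg _) (Ne.symm h0)
    apply mul_nonneg (by positivity)
    apply Real.log_nonneg
    rw [le_div_iff₀ hp]; linarith

lemma wt_int {n : ℕ} (hn : 1 ≤ n) :
    ∫⁻ z in ball (0 : En n) (1 / 2), ENNReal.ofReal (‖z‖ ^ 2) * ENNReal.ofReal (wt z) ≠ ∞ := by
  have := sig_prob hn
  have hw := wt_meas n
  have hm : Measurable (fun z : En n => ENNReal.ofReal (‖z‖ ^ 2) * ENNReal.ofReal (wt z)) := by fun_prop
  rw [← lintegral_indicator measurableSet_ball, polar hn (hm.indicator measurableSet_ball)]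
  refine ENNReal.mul_ne_top (cS_ne_top n) ?_
  refine ne_top_of_le_ne_top (b := ENNReal.ofReal (1 / 2)) ENNReal.ofReal_ne_top ?_
  calc _ ≤ ∫⁻ ζ, ENNReal.ofReal (1 / 2) ∂(sig n) := by
        apply lintegral_mono_ae
        filter_upwards [ae_sig_norm n] with ζ hζ
        calc _ ≤ ∫⁻ r in Ioi (0:ℝ), (Ioo (0:ℝ) (1/2)).indicator (fun _ => (1:ℝ≥0∞)) r := by
              apply setLIntegral_mono' measurableSet_Ioi
              intro r hr
              have hr0 : 0 < r := hr
              have hnt : ‖r • ζ‖ = r := by rw [norm_smul, hζ, Real.norm_eq_abs, abs_of_pos hr0, mul_one]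
              by_cases hr2 : r < 1 / 2
              · rw [Set.indicator_of_mem (by rw [mem_ball_zero_iff, hnt]; exact hr2),
                  Set.indicator_of_mem (show r ∈ Ioo (0:ℝ) (1/2) from ⟨hr0, hr2⟩)]
                have hwn := wt_nonneg (r • ζ) (by rw [hnt]; linarith)
                rw [← ENNReal.ofReal_mul (by positivity), ← ENNReal.ofReal_mul (by positivity),
                  ENNReal.ofReal_le_one]
                unfold wt
                rw [hnt]
                have e1 : r ^ (-2 * (n:ℝ)) * r ^ (2 * n - 1) = r⁻¹ := by
                  rw [← Real.rpow_natCast r (2 * n - 1), ← Real.rpow_add hr0, ← Real.rpow_neg_one]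
                  congr 1
                  rw [Nat.cast_sub (by omega)]; push_cast; ring
                have e2 : Real.log (1 / r) ≤ 1 / r - 1 := Real.log_le_sub_one_of_pos (by positivity)
                calc r ^ 2 * (r ^ (-2 * (n:ℝ)) * Real.log (1 / r)) * r ^ (2 * n - 1)
                    = r ^ 2 * (r ^ (-2 * (n:ℝ)) * r ^ (2 * n - 1)) * Real.log (1 / r) := by ring
                  _ = r * Real.log (1 / r) := by rw [e1]; field_simp
                  _ ≤ r * (1 / r - 1) := by gcongr
                  _ = 1 - r := by field_simp
                  _ ≤ 1 := by linarith
              · rw [Set.indicator_of_notMem (by rw [mem_ball_zero_iff, hnt]; exact hr2), zero_mul]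
                exact zero_le
          _ ≤ ∫⁻ r, (Ioo (0:ℝ) (1/2)).indicator (fun _ => (1:ℝ≥0∞)) r := setLIntegral_le_lintegral _ _
          _ = ENNReal.ofReal (1 / 2) := by
              rw [lintegral_indicator_const measurableSet_Ioo, Real.volume_Ioo]; norm_num
    _ = _ := by simp


lemma inner_part {n : ℕ} (hn : 1 ≤ n) : ∃ C : ℝ≥0∞, C ≠ ∞ ∧ ∀ f g : En n → l2,
    DifferentiableOn ℂ f (ball 0 1) → DifferentiableOn ℂ g (ball 0 1) →
    ∫⁻ z in ball (0 : En n) (1 / 2), ENNReal.ofReal (‖f z‖ * ‖radD g z‖ ^ 2 * wt z) ≤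
      C * cmG g * h1Ball f := by
  obtain ⟨Cf, hCf, hf'⟩ := f_sup hn
  obtain ⟨Cd, hCd, hd'⟩ := radD_sup hn
  set W := ∫⁻ z in ball (0 : En n) (1 / 2), ENNReal.ofReal (‖z‖ ^ 2) * ENNReal.ofReal (wt z) with hW
  have hWt : W ≠ ∞ := wt_int hn
  refine ⟨ENNReal.ofReal (4 ^ (2 * n)) * Cf * Cd * W, by finiteness, fun f g hf hg => ?_⟩
  have hw := wt_meas n
  have hm : Measurable (fun z : En n => ENNReal.ofReal (‖z‖ ^ 2) * ENNReal.ofReal (wt z)) := by fun_prop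
  calc _ ≤ ∫⁻ z in ball (0 : En n) (1 / 2), (ENNReal.ofReal (4 ^ (2 * n)) * (Cf * h1Ball f) * (Cd * cmG g)) *
        (ENNReal.ofReal (‖z‖ ^ 2) * ENNReal.ofReal (wt z)) := by
        apply setLIntegral_mono' measurableSet_ball
        intro z hz
        rw [mem_ball_zero_iff] at hz
        rw [ENNReal.ofReal_mul (by positivity), ENNReal.ofReal_mul (norm_nonneg _)]
        have h1 := hf' f hf z (by linarith)
        have h2 := hd' g hg z hz
        have h3 : ENNReal.ofReal ‖f z‖ ≤ ENNReal.ofReal (4 ^ (2 * n)) * (Cf * h1Ball f) := by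
          calc ENNReal.ofReal ‖f z‖ ≤ ENNReal.ofReal (4 ^ (2 * n)) *
                (ENNReal.ofReal (((1 - ‖z‖) / 2) ^ (2 * n)) * ENNReal.ofReal ‖f z‖) := by
                rw [← mul_assoc, ← ENNReal.ofReal_mul (by positivity), ← mul_pow]
                apply le_mul_of_one_le_left zero_le
                rw [← ENNReal.ofReal_one]
                apply ENNReal.ofReal_le_ofReal
                exact one_le_pow₀ (by linarith)
            _ ≤ _ := mul_le_mul_right h1 _
        calc _ ≤ (ENNReal.ofReal (4 ^ (2 * n)) * (Cf * h1Ball f)) * (Cd * cmG g * ENNReal.ofReal (‖z‖ ^ 2)) *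
              ENNReal.ofReal (wt z) := mul_le_mul_left (mul_le_mul' h3 h2) _
          _ = _ := by ring
    _ = (ENNReal.ofReal (4 ^ (2 * n)) * (Cf * h1Ball f) * (Cd * cmG g)) * W := by
        rw [lintegral_const_mul _ hm]
    _ = _ := by ring

lemma outer_part {n : ℕ} (hn : 1 ≤ n) : ∃ C : ℝ≥0∞, C ≠ ∞ ∧ ∀ f g : En n → l2,
    DifferentiableOn ℂ f (ball 0 1) → cmG g ≠ ∞ →
    ∫⁻ z in ball (0 : En n) 1 \ ball (0 : En n) (1 / 2), ENNReal.ofReal (‖f z‖ * ‖radD g z‖ ^ 2 * wt z) ≤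
      C * cmG g * h1Ball f := by
  obtain ⟨C, hC, h⟩ := embed hn
  set K : ℝ≥0∞ := ENNReal.ofReal (2 ^ (2 * n) * 2) with hK
  refine ⟨K * C, by finiteness, fun f g hf hM => ?_⟩
  have hE := h f g hf hM
  have hmu : ∫⁻ z, ENNReal.ofReal ‖f z‖ ∂(muM g) =
      ∫⁻ z in ball (0 : En n) 1, ENNReal.ofReal (hsSq g z * (1 - ‖z‖ ^ 2)) * ENNReal.ofReal ‖f z‖ := by
    rw [muM, lintegral_withDensity_eq_lintegral_mul_non_measurable _ (dens_meas g)]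
    · rfl
    · exact Filter.Eventually.of_forall fun z => ENNReal.ofReal_lt_top
  calc _ ≤ ∫⁻ z in ball (0 : En n) 1 \ ball (0 : En n) (1 / 2),
        K * (ENNReal.ofReal (hsSq g z * (1 - ‖z‖ ^ 2)) * ENNReal.ofReal ‖f z‖) := by
        apply setLIntegral_mono' (measurableSet_ball.diff measurableSet_ball)
        rintro z ⟨hz1, hz2⟩
        rw [mem_ball_zero_iff] at hz1 hz2
        push Not at hz2
        have hz0 : 0 < ‖z‖ := by linarith
        have hs := hsSq_nonneg g z
        have hq : 0 ≤ 1 - ‖z‖ ^ 2 := by nlinarith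
        rw [hK, ← ENNReal.ofReal_mul (by positivity), ← ENNReal.ofReal_mul (by positivity)]
        apply ENNReal.ofReal_le_ofReal
        have h1 : ‖radD g z‖ ^ 2 ≤ hsSq g z := by
          refine (radD_le g z).trans ?_
          nlinarith
        have h2 : wt z ≤ 2 ^ (2 * n) * (2 * (1 - ‖z‖ ^ 2)) := by
          unfold wt
          have e1 : ‖z‖ ^ (-2 * (n:ℝ)) ≤ 2 ^ (2 * n) := by
            have : ‖z‖ ^ (-2 * (n:ℝ)) = (‖z‖⁻¹) ^ (2 * n) := by
              rw [show -2 * (n:ℝ) = -((2 * n : ℕ) : ℝ) by push_cast; ring, Real.rpow_neg hz0.le,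
                Real.rpow_natCast, inv_pow]
            rw [this]
            apply pow_le_pow_left₀ (by positivity)
            rw [inv_le_comm₀ hz0 (by norm_num)]; linarith
          have e2 : Real.log (1 / ‖z‖) ≤ 2 * (1 - ‖z‖ ^ 2) := by
            refine (Real.log_le_sub_one_of_pos (by positivity)).trans ?_
            rw [sub_le_iff_le_add, div_le_iff₀ hz0]
            nlinarith [mul_nonneg hz0.le (sub_nonneg.2 hz1.le), mul_nonneg (sub_nonneg.2 hz2) (sub_nonneg.2 hz1.le),
              mul_nonneg (mul_nonneg hz0.le (sub_nonneg.2 hz2)) (sub_nonneg.2 hz1.le)]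
          have e3 : 0 ≤ Real.log (1 / ‖z‖) := by
            apply Real.log_nonneg; rw [le_div_iff₀ hz0]; linarith
          exact mul_le_mul e1 e2 e3 (by positivity)
        have h3 := wt_nonneg z hz1
        calc ‖f z‖ * ‖radD g z‖ ^ 2 * wt z ≤ ‖f z‖ * hsSq g z * (2 ^ (2 * n) * (2 * (1 - ‖z‖ ^ 2))) := by
              gcongr
          _ = _ := by ring
    _ ≤ ∫⁻ z in ball (0 : En n) 1, K * (ENNReal.ofReal (hsSq g z * (1 - ‖z‖ ^ 2)) * ENNReal.ofReal ‖f z‖) :=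
        lintegral_mono_set diff_subset
    _ = K * ∫⁻ z, ENNReal.ofReal ‖f z‖ ∂(muM g) := by
        rw [hmu, lintegral_const_mul' _ _ ENNReal.ofReal_ne_top]
    _ ≤ K * (C * cmG g * h1Ball f) := mul_le_mul_right hE _
    _ = _ := by ring

lemma f_zero {n : ℕ} (hn : 1 ≤ n) {f : En n → l2} (hf : DifferentiableOn ℂ f (ball 0 1)) (h0 : h1Ball f = 0)
    (z : En n) (hz : ‖z‖ < 1) : ‖f z‖ = 0 := by
  obtain ⟨C, hC, h⟩ := f_sup hn
  have h1 := h f hf z hz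
  rw [h0, mul_zero, nonpos_iff_eq_zero, mul_eq_zero] at h1
  rcases h1 with h1 | h1
  · rw [ENNReal.ofReal_eq_zero] at h1
    have : 0 < ((1 - ‖z‖) / 2) ^ (2 * n) := by
      apply pow_pos; linarith
    linarith
  · rw [ENNReal.ofReal_eq_zero] at h1
    exact le_antisymm h1 (norm_nonneg _)

theorem hormander_carleson_H1 (n : ℕ) (hn : 1 ≤ n) :
    ∃ C : ℝ, 0 < C ∧
      ∀ f g : En n → l2,
        DifferentiableOn ℂ f (ball (0 : En n) 1) →
        DifferentiableOn ℂ g (ball (0 : En n) 1) →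
        (∫⁻ z in ball (0 : En n) 1,
            ENNReal.ofReal
              (‖f z‖ * ‖radD g z‖ ^ 2 *
                (‖z‖ ^ (-2 * (n : ℝ)) * Real.log (1 / ‖z‖))) ∂volume) ≤
          ENNReal.ofReal C *
            cmSq (fun z => (1 - ‖z‖ ^ 2) ^ ((n : ℝ) / 2 + 1) * Real.sqrt (hsSq g z)) *
            h1Ball f := by
  obtain ⟨Ci, hCi, hi⟩ := inner_part hn
  obtain ⟨Co, hCo, ho⟩ := outer_part hn
  refine ⟨(Ci + Co).toReal + 1, by positivity, fun f g hf hg => ?_⟩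
  change ∫⁻ z in ball (0 : En n) 1, ENNReal.ofReal (‖f z‖ * ‖radD g z‖ ^ 2 * wt z) ≤
    ENNReal.ofReal ((Ci + Co).toReal + 1) * cmG g * h1Ball f
  have hCC : Ci + Co ≤ ENNReal.ofReal ((Ci + Co).toReal + 1) := by
    rw [← ENNReal.ofReal_toReal (show Ci + Co ≠ ∞ by finiteness)]
    apply ENNReal.ofReal_le_ofReal
    rw [ENNReal.ofReal_toReal (by finiteness)]
    linarith
  by_cases hh : h1Ball f = 0
  · have : ∫⁻ z in ball (0 : En n) 1, ENNReal.ofReal (‖f z‖ * ‖radD g z‖ ^ 2 * wt z) = 0 := by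
      rw [setLIntegral_congr_fun (g := fun _ => 0) measurableSet_ball]
      · simp
      · intro z hz
        beta_reduce
        rw [f_zero hn hf hh z (mem_ball_zero_iff.1 hz)]; simp
    rw [this]; exact zero_le
  by_cases hM : cmG g = ∞
  · rw [hM, ENNReal.mul_top, ENNReal.top_mul hh]
    · exact le_top
    · rw [Ne, ENNReal.ofReal_eq_zero, not_le]; positivity
  calc _ = ∫⁻ z in ball (0 : En n) (1 / 2) ∪ (ball (0 : En n) 1 \ ball (0 : En n) (1 / 2)),
        ENNReal.ofReal (‖f z‖ * ‖radD g z‖ ^ 2 * wt z) := by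
        rw [Set.union_diff_cancel (ball_subset_ball (by norm_num))]
    _ ≤ _ := lintegral_union_le _ _ _
    _ ≤ Ci * cmG g * h1Ball f + Co * cmG g * h1Ball f := add_le_add (hi f g hf hg) (ho f g hf hM)
    _ = (Ci + Co) * cmG g * h1Ball f := by ring
    _ ≤ _ := by gcongr
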